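/- arXiv:1712.07863 — 3 statements merged into one kernel-verified Lean document; each statement's English description precedes it below -/
import Mathlib

section
/- (Information dimension rate equals rate-distortion dimension.) Let {X_t, t ∈ ℤ} be a stationary L-variate real-valued process. Then the upper information dimension rate d̄({X_t}) equals the upper rate-distortion dimension 2·limsup_{D↓0} (lim_{k→∞} R(X_1^k, kD)/k) / (−log D), and the lower information dimension rate d̲({X_t}) equals the corresponding lower rate-distortion dimension with liminf over D; here the limit over k exists by stationarity. -/
open MeasureTheory ProbabilityTheory Filter Set
open scoped ENNReal NNReal

/-- Uniform quantization with step size `1/m`: `[x]_m = ⌊m x⌋ / m`. -/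
noncomputable def quant (m : ℕ) (x : ℝ) : ℝ := ⌊(m : ℝ) * x⌋ / m

/-- Shannon entropy (in nats) of a random element `X`, valued in `[0,∞]`. -/
noncomputable def entropy {Ω S : Type*} [MeasurableSpace Ω] (μ : Measure Ω) (X : Ω → S) : ℝ≥0∞ :=
  ∑' s : S, ENNReal.ofReal (Real.negMulLog (μ (X ⁻¹' {s})).toReal)

/-- Componentwise quantization of the block `X_1^k` of an `ι`-variate process. -/
noncomputable def blockQ {Ω ι : Type*} (m k : ℕ) (X : ℤ → Ω → ι → ℝ) :
    Ω → Fin k → ι → ℝ :=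
  fun ω j i => quant m (X ((j : ℤ) + 1) ω i)

/-- Entropy rate `H̄_m` of the process quantized with step `1/m`; by stationarity and
subadditivity of entropy, the limit over the block length `k` equals the infimum. -/
noncomputable def entRate {Ω ι : Type*} [MeasurableSpace Ω] (μ : Measure Ω)
    (X : ℤ → Ω → ι → ℝ) (m : ℕ) : ℝ≥0∞ :=
  ⨅ k : ℕ, entropy μ (blockQ m (k + 1) X) / ((k : ℝ≥0∞) + 1)

/-- Upper information dimension rate `d̄({X_t}) = limsup_m H̄_m / log m`. -/
noncomputable def dimRateUpper {Ω ι : Type*} [MeasurableSpace Ω] (μ : Measure Ω)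
    (X : ℤ → Ω → ι → ℝ) : ℝ≥0∞ :=
  Filter.limsup (fun m : ℕ => entRate μ X m / ENNReal.ofReal (Real.log m)) Filter.atTop

/-- Lower information dimension rate `d̲({X_t}) = liminf_m H̄_m / log m`. -/
noncomputable def dimRateLower {Ω ι : Type*} [MeasurableSpace Ω] (μ : Measure Ω)
    (X : ℤ → Ω → ι → ℝ) : ℝ≥0∞ :=
  Filter.liminf (fun m : ℕ => entRate μ X m / ENNReal.ofReal (Real.log m)) Filter.atTop

/-- Stationarity: every shift of the process has the same (joint) law. -/
def Stationary {Ω ι : Type*} [MeasurableSpace Ω] (μ : Measure Ω) (X : ℤ → Ω → ι → ℝ) : Prop :=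
  ∀ n : ℤ, μ.map (fun ω (t : ℤ) => X (t + n) ω) = μ.map (fun ω (t : ℤ) => X t ω)

attribute [local instance] Classical.propDecidable

/-- Kullback–Leibler divergence between measures, valued in `[0,∞]`
(`∞` unless `π ≪ ρ` and the log-likelihood ratio is `π`-integrable). -/
noncomputable def KL {α : Type*} [MeasurableSpace α] (π ρ : Measure α) : ℝ≥0∞ :=
  if π ≪ ρ ∧ Integrable (fun x => Real.log ((π.rnDeriv ρ x).toReal)) π then
    ENNReal.ofReal (∫ x, Real.log ((π.rnDeriv ρ x).toReal) ∂π)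
  else ⊤

/-- Rate-distortion function (squared-error distortion) of the law `ν` of a random vector:
the infimum of the mutual information `KL(π ‖ π₁ ⊗ π₂)` over couplings `π` with first
marginal `ν` and expected squared Euclidean distortion at most `D`. -/
noncomputable def RD {ι : Type*} [Fintype ι] (ν : Measure (ι → ℝ)) (D : ℝ) : ℝ≥0∞ :=
  ⨅ (π : Measure ((ι → ℝ) × (ι → ℝ))) (_ : IsProbabilityMeasure π)
    (_ : π.map Prod.fst = ν)
    (_ : ∫⁻ p, ENNReal.ofReal (∑ i, (p.1 i - p.2 i) ^ 2) ∂π ≤ ENNReal.ofReal D),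
    KL π ((π.map Prod.fst).prod (π.map Prod.snd))

namespace RDaux
open InformationTheory

lemma KL_eq_klDiv {α : Type*} [MeasurableSpace α] (π ρ : Measure α) [IsProbabilityMeasure π]
    [IsProbabilityMeasure ρ] : KL π ρ = klDiv π ρ := by
  unfold KL
  by_cases h : π ≪ ρ ∧ Integrable (llr π ρ) π
  · rw [klDiv_of_ac_of_integrable h.1 h.2]
    refine (if_pos h).trans ?_
    simp [llr]
  · rw [klDiv_eq_top_iff.2 (by tauto)]
    exact if_neg h

lemma klDiv_swap {α β : Type*} [MeasurableSpace α] [MeasurableSpace β] (π ρ : Measure (α × β))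
    [IsProbabilityMeasure π] [IsProbabilityMeasure ρ] :
    klDiv π ρ ≤ klDiv (π.map Prod.swap) (ρ.map Prod.swap) := by
  have := klDiv_map_le (μ := π.map Prod.swap) (ν := ρ.map Prod.swap) (g := Prod.swap) measurable_swap
  rwa [Measure.map_map measurable_swap measurable_swap, Measure.map_map measurable_swap measurable_swap,
    Prod.swap_swap_eq, Measure.map_id, Measure.map_id] at this

lemma golden {α β : Type*} [MeasurableSpace α] [MeasurableSpace β] [StandardBorelSpace α] [Nonempty α]
    (π : Measure (α × β)) [IsProbabilityMeasure π] (P : Measure α) [IsProbabilityMeasure P]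
    (q : Measure β) [IsProbabilityMeasure q] :
    klDiv π (P.prod (π.map Prod.snd)) ≤ klDiv π (P.prod q) := by
  have i1 : IsProbabilityMeasure (π.map Prod.snd) := Measure.isProbabilityMeasure_map (by fun_prop)
  have i2 : IsProbabilityMeasure (π.map Prod.swap) := Measure.isProbabilityMeasure_map (by fun_prop)
  refine (klDiv_swap _ _).trans ?_
  rw [Measure.prod_swap]
  have h2 := klDiv_map_le (μ := π) (ν := P.prod q) (g := Prod.swap) measurable_swap
  rw [Measure.prod_swap] at h2
  refine le_trans ?_ h2
  have h3 : (π.map Prod.swap) = (π.map Prod.snd) ⊗ₘ (π.map Prod.swap).condKernel := by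
    conv_lhs => rw [← (π.map Prod.swap).disintegrate (π.map Prod.swap).condKernel]
    rw [Measure.fst, Measure.map_map measurable_fst measurable_swap]; rfl
  rw [h3, ← Measure.compProd_const, ← Measure.compProd_const, klDiv_compProd_eq_add (μ := π.map Prod.snd)
    (ν := q)]
  exact le_add_self

lemma KL_le_of_density {α : Type*} [MeasurableSpace α] (π ρ : Measure α) [IsProbabilityMeasure π]
    [IsProbabilityMeasure ρ] (f : α → ℝ≥0∞) (hf : Measurable f) (h : π = ρ.withDensity f)
    (hi : Integrable (fun x => Real.log (f x).toReal) π) :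
    klDiv π ρ = ENNReal.ofReal (∫ x, Real.log (f x).toReal ∂π) := by
  have ac : π ≪ ρ := h ▸ withDensity_absolutelyContinuous _ _
  have e : llr π ρ =ᵐ[π] fun x => Real.log (f x).toReal := by
    have := Measure.rnDeriv_withDensity ρ hf
    rw [← h] at this
    filter_upwards [ac this] with x hx
    simp [llr, hx]
  rw [klDiv_of_ac_of_integrable ac (hi.congr e.symm)]
  simp [integral_congr_ae e]

lemma gibbs {α : Type*} [MeasurableSpace α] (π ρ : Measure α) [IsProbabilityMeasure π]
    [IsProbabilityMeasure ρ] (a b : α → ℝ) (ha : ∀ x, 0 ≤ a x) (hb : ∀ x, 0 ≤ b x)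
    (ham : Measurable a) (hbm : Measurable b)
    (G : α → ℝ≥0∞) (hG : Measurable G) (hG1 : ∫⁻ x, G x ∂ρ ≤ 1)
    (hab : ∀ x, ENNReal.ofReal (Real.exp (a x - b x)) ≤ G x) :
    ∫⁻ x, ENNReal.ofReal (a x) ∂π ≤ ∫⁻ x, ENNReal.ofReal (b x) ∂π + klDiv π ρ := by
  by_cases hk : klDiv π ρ = ⊤
  · simp [hk]
  obtain ⟨ac, hi⟩ := klDiv_ne_top_iff.1 hk
  rw [klDiv_of_ac_of_integrable ac hi]
  simp only [probReal_univ, add_sub_cancel_right]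
  set f := π.rnDeriv ρ with hf
  have hfm : Measurable f := Measure.measurable_rnDeriv _ _
  have hpos : ∀ᵐ x ∂π, 0 < f x := Measure.rnDeriv_pos ac
  have hfin : ∀ᵐ x ∂π, f x < ⊤ := ac (Measure.rnDeriv_lt_top _ _)
  have hlm : Measurable (llr π ρ) := measurable_llr _ _
  have hGf : ∫⁻ x, G x / f x ∂π ≤ 1 := by
    rw [← lintegral_rnDeriv_mul ac (by fun_prop)]
    refine le_trans (lintegral_mono fun x => ?_) hG1
    exact ENNReal.mul_div_le
  have key : ∀ᵐ x ∂π, ENNReal.ofReal (a x) + 1 + ENNReal.ofReal (-llr π ρ x) ≤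
      ENNReal.ofReal (b x) + ENNReal.ofReal (llr π ρ x) + G x / f x := by
    filter_upwards [hpos, hfin] with x h0 h1
    have ft : 0 < (f x).toReal := ENNReal.toReal_pos h0.ne' h1.ne
    have e1 : ENNReal.ofReal (Real.exp (a x - b x) / (f x).toReal) ≤ G x / f x := by
      rw [ENNReal.ofReal_div_of_pos ft, ENNReal.ofReal_toReal h1.ne]
      exact ENNReal.div_le_div_right (hab x) _
    refine le_trans ?_ (add_le_add_right e1 _)
    have e2 : Real.exp (a x - b x) / (f x).toReal = Real.exp (a x - b x - llr π ρ x) := by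
      rw [Real.exp_sub _ (llr π ρ x), llr, Real.exp_log ft]
    rw [e2]
    have e3 := Real.add_one_le_exp (a x - b x - llr π ρ x)
    rcases le_total 0 (llr π ρ x) with h | h
    · rw [ENNReal.ofReal_of_nonpos (by linarith : -llr π ρ x ≤ 0), add_zero,
        ← ENNReal.ofReal_one, ← ENNReal.ofReal_add (ha x) zero_le_one,
        ← ENNReal.ofReal_add (hb x) h, ← ENNReal.ofReal_add (by linarith [hb x]) (Real.exp_pos _).le]
      exact ENNReal.ofReal_le_ofReal (by linarith)
    · rw [ENNReal.ofReal_of_nonpos h, add_zero,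
        ← ENNReal.ofReal_one, ← ENNReal.ofReal_add (ha x) zero_le_one,
        ← ENNReal.ofReal_add (by linarith [ha x]) (by linarith),
        ← ENNReal.ofReal_add (hb x) (Real.exp_pos _).le]
      exact ENNReal.ofReal_le_ofReal (by linarith)
  have I := lintegral_mono_ae key
  rw [lintegral_add_left (by fun_prop), lintegral_add_left (by fun_prop),
    lintegral_add_left (by fun_prop), lintegral_add_left (by fun_prop)] at I
  simp only [lintegral_const, measure_univ, mul_one] at I
  have hp : ∫⁻ x, ENNReal.ofReal (llr π ρ x) ∂π ≠ ⊤ := hi.lintegral_lt_top.ne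
  have hn : ∫⁻ x, ENNReal.ofReal (-llr π ρ x) ∂π ≠ ⊤ := hi.neg.lintegral_lt_top.ne
  rw [integral_eq_lintegral_pos_part_sub_lintegral_neg_part hi,
    ENNReal.ofReal_sub _ ENNReal.toReal_nonneg, ENNReal.ofReal_toReal hp, ENNReal.ofReal_toReal hn]
  have hle : ∫⁻ x, ENNReal.ofReal (-llr π ρ x) ∂π ≤ ∫⁻ x, ENNReal.ofReal (llr π ρ x) ∂π := by
    have := integral_llr_add_sub_measure_univ_nonneg ac hi
    simp only [probReal_univ, add_sub_cancel_right] at this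
    rw [integral_eq_lintegral_pos_part_sub_lintegral_neg_part hi, sub_nonneg,
      ENNReal.toReal_le_toReal hn hp] at this
    exact this
  have I2 := I.trans (add_le_add_right hGf _)
  rw [← ENNReal.add_le_add_iff_right ENNReal.one_ne_top, ← ENNReal.add_le_add_iff_right hn]
  refine I2.trans (le_of_eq ?_)
  rw [add_right_comm _ 1 _, add_assoc (∫⁻ x, ENNReal.ofReal (b x) ∂π) _ (∫⁻ x, ENNReal.ofReal (-llr π ρ x) ∂π),
    tsub_add_cancel_of_le hle]

/-- entropy of a law on a countable space -/
noncomputable def Ent {T : Type*} [MeasurableSpace T] (Q : Measure T) : ℝ≥0∞ :=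
  ∫⁻ z, ENNReal.ofReal (-Real.log (Q {z}).toReal) ∂Q

/-- integer quantization -/
noncomputable def Zq {ι : Type*} (m : ℕ) (x : ι → ℝ) : ι → ℤ := fun i => ⌊(m : ℝ) * x i⌋

lemma measurable_Zq {ι : Type*} (m : ℕ) : Measurable (Zq (ι := ι) m) := by
  unfold Zq
  exact measurable_pi_lambda _ fun i => Int.measurable_floor.comp (by fun_prop)

lemma Ent_eq_tsum {T : Type*} [MeasurableSpace T] [Countable T] [MeasurableSingletonClass T]
    (Q : Measure T) [IsProbabilityMeasure Q] :
    Ent Q = ∑' z, ENNReal.ofReal (Real.negMulLog (Q {z}).toReal) := by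
  rw [Ent, lintegral_countable']
  refine tsum_congr fun z => ?_
  have h1 : (Q {z}) = ENNReal.ofReal (Q {z}).toReal := (ENNReal.ofReal_toReal (by simp)).symm
  have h2 : (Q {z}).toReal ≤ 1 := by
    simpa using ENNReal.toReal_mono ENNReal.one_ne_top (prob_le_one (μ := Q) (s := {z}))
  conv_lhs => rw [mul_comm, h1]
  simp only [ENNReal.ofReal_toReal (measure_ne_top Q _)]
  rw [← ENNReal.ofReal_toReal (measure_ne_top Q {z}), ← ENNReal.ofReal_mul ENNReal.toReal_nonneg]
  simp [Real.negMulLog]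

lemma entropy_eq {Ω : Type*} [MeasurableSpace Ω] (μ : Measure Ω) [IsProbabilityMeasure μ]
    (L : ℕ) (X : ℤ → Ω → Fin L → ℝ) (hmeas : ∀ t, Measurable (X t)) (m k : ℕ) (hm : 1 ≤ m) :
    entropy μ (blockQ m k X) =
      Ent ((μ.map (fun ω (p : Fin k × Fin L) => X ((p.1 : ℤ) + 1) ω p.2)).map (Zq m)) := by
  have hm0 : (m : ℝ) ≠ 0 := by positivity
  have hB : Measurable (fun ω (p : Fin k × Fin L) => X ((p.1 : ℤ) + 1) ω p.2) :=
    measurable_pi_lambda _ fun p => (measurable_pi_apply p.2).comp (hmeas _)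
  rw [Measure.map_map (measurable_Zq m) hB]
  have := Measure.isProbabilityMeasure_map (μ := μ) ((measurable_Zq m).comp hB).aemeasurable
  rw [Ent_eq_tsum, entropy]
  let g : (Fin k × Fin L → ℤ) → (Fin k → Fin L → ℝ) := fun z j i => (z (j, i) : ℝ) / m
  have hg : Function.Injective g := by
    intro z w h
    funext ⟨j, i⟩
    have := congrFun (congrFun h j) i
    simp only [g] at this
    rw [div_left_inj' hm0] at this
    exact_mod_cast this
  rw [← hg.tsum_eq (f := fun s => ENNReal.ofReal (Real.negMulLog (μ (blockQ m k X ⁻¹' {s})).toReal))]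
  · refine tsum_congr fun z => ?_
    rw [Measure.map_apply ((measurable_Zq m).comp hB) (measurableSet_singleton z)]
    have hset : blockQ m k X ⁻¹' {g z} =
        (Zq m ∘ fun ω (p : Fin k × Fin L) => X ((p.1 : ℤ) + 1) ω p.2) ⁻¹' {z} := ?_
    · rw [hset]
    ext ω
    simp only [mem_preimage, mem_singleton_iff, Function.comp, funext_iff, blockQ, quant, g, Zq,
      div_left_inj' hm0, Int.cast_inj, Prod.forall]
  · intro s hs
    by_contra hns
    apply hs
    have : blockQ m k X ⁻¹' {s} = ∅ := by
      ext ω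
      simp only [mem_preimage, mem_singleton_iff, mem_empty_iff_false, iff_false]
      intro h
      exact hns ⟨fun p => ⌊(m : ℝ) * X ((p.1 : ℤ) + 1) ω p.2⌋, by rw [← h]; rfl⟩
    simp [this]

lemma exists_q : ∃ (q : Measure ℤ) (c0 : ℝ), IsProbabilityMeasure q ∧ 0 ≤ c0 ∧
    ∀ z : ℤ, q {z} = ENNReal.ofReal (Real.exp (-(|(z : ℝ)| + c0))) := by
  have hs : Summable (fun z : ℤ => Real.exp (-|(z : ℝ)|)) := by
    apply Summable.of_nat_of_neg <;> simpa using Real.summable_exp_neg_nat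
  set S := ∑' z : ℤ, Real.exp (-|(z : ℝ)|) with hS
  have h1 : 1 ≤ S := by
    simpa using hs.le_tsum 0 (fun _ _ => (Real.exp_pos _).le)
  have hS0 : 0 < S := by linarith
  have hq : ∀ z : ℤ, Real.exp (-(|(z : ℝ)| + Real.log S)) = Real.exp (-|(z : ℝ)|) / S := by
    intro z
    rw [neg_add, ← sub_eq_add_neg, Real.exp_sub, Real.exp_log hS0]
  have hsum : HasSum (fun z : ℤ => Real.exp (-(|(z : ℝ)| + Real.log S))) 1 := by
    simp_rw [hq]
    have := hs.hasSum.div_const S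
    rwa [div_self hS0.ne'] at this
  have hsum' : HasSum (fun z : ℤ => ENNReal.ofReal (Real.exp (-(|(z : ℝ)| + Real.log S)))) 1 := by
    have := ENNReal.ofReal_tsum_of_nonneg (fun z => (Real.exp_pos _).le) hsum.summable
    rw [hsum.tsum_eq, ENNReal.ofReal_one] at this
    rw [this]
    exact ENNReal.summable.hasSum
  let p : PMF ℤ := ⟨_, hsum'⟩
  refine ⟨p.toMeasure, Real.log S, inferInstance, Real.log_nonneg h1, fun z => ?_⟩
  rw [PMF.toMeasure_apply_singleton _ _ (measurableSet_singleton z)]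
  rfl

lemma tsum_singleton {T : Type*} [MeasurableSpace T] [Countable T] [MeasurableSingletonClass T]
    (Q : Measure T) [IsProbabilityMeasure Q] : ∑' z, Q {z} = 1 := by
  have := lintegral_countable' (μ := Q) (fun _ => 1)
  simpa using this.symm

lemma floor_bound (m : ℕ) (x y : ℝ) :
    |((⌊(m : ℝ) * x⌋ - ⌊(m : ℝ) * y⌋ : ℤ) : ℝ)| ≤ (m : ℝ) ^ 2 * (x - y) ^ 2 + 2 := by
  have h1 := Int.floor_le ((m : ℝ) * x)
  have h2 := Int.lt_floor_add_one ((m : ℝ) * x)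
  have h3 := Int.floor_le ((m : ℝ) * y)
  have h4 := Int.lt_floor_add_one ((m : ℝ) * y)
  push_cast
  rw [abs_le]
  constructor <;> nlinarith [sq_nonneg ((m : ℝ) * (x - y) - 1), sq_nonneg ((m : ℝ) * (x - y) + 1)]

lemma LB {q : Measure ℤ} {c0 : ℝ} [IsProbabilityMeasure q] (hc0 : 0 ≤ c0)
    (hq : ∀ z : ℤ, q {z} = ENNReal.ofReal (Real.exp (-(|(z : ℝ)| + c0))))
    {ι κ : Type*} [Fintype ι] [Fintype κ] (e : κ → ι) (he : Function.Injective e)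
    (ν : Measure (ι → ℝ)) (D : ℝ) (hD : 0 ≤ D) (m : ℕ) :
    Ent ((ν.map (fun x j => x (e j))).map (Zq m)) ≤
      RD ν D + ENNReal.ofReal ((m : ℝ) ^ 2 * D + Fintype.card κ * (2 + c0)) := by
  rw [← tsub_le_iff_right]
  unfold RD
  refine le_iInf fun π => le_iInf fun hπ => le_iInf fun hfst => le_iInf fun hdist => ?_
  rw [tsub_le_iff_right]
  have i1 : IsProbabilityMeasure (π.map Prod.fst) := Measure.isProbabilityMeasure_map (by fun_prop)
  have i2 : IsProbabilityMeasure (π.map Prod.snd) := Measure.isProbabilityMeasure_map (by fun_prop)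
  rw [KL_eq_klDiv, ← hfst]
  have he_m : Measurable (fun (x : ι → ℝ) (j : κ) => x (e j)) := by fun_prop
  rw [Measure.map_map (measurable_Zq m) he_m]
  set V : (ι → ℝ) → (κ → ℤ) := Zq m ∘ (fun (x : ι → ℝ) (j : κ) => x (e j)) with hV
  have hVm : Measurable V := (measurable_Zq m).comp he_m
  set Q := (π.map Prod.fst).map V with hQ
  have iQ : IsProbabilityMeasure Q := Measure.isProbabilityMeasure_map hVm.aemeasurable
  set W : Measure (κ → ℤ) := Measure.pi (fun _ => q) with hW
  set β : (κ → ℤ) → ℝ := fun z => ∑ j, (|(z j : ℝ)| + c0) with hβ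
  have hWz : ∀ z, W {z} = ENNReal.ofReal (Real.exp (-β z)) := by
    intro z
    rw [hW, Measure.pi_singleton]
    simp_rw [hq]
    rw [← ENNReal.ofReal_prod_of_nonneg (fun _ _ => (Real.exp_pos _).le), ← Real.exp_sum,
      Finset.sum_neg_distrib]
  have hle1 : ∀ z, (Q {z}).toReal ≤ 1 := fun z => by
    simpa using ENNReal.toReal_mono ENNReal.one_ne_top (prob_le_one (μ := Q) (s := {z}))
  have hEnt : Ent Q = ∫⁻ p, ENNReal.ofReal (-Real.log (Q {V p.1}).toReal) ∂π := by
    have hm1 : Measurable fun z : κ → ℤ => ENNReal.ofReal (-Real.log (Q {z}).toReal) :=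
      measurable_of_countable _
    rw [Ent]
    conv_lhs => rw [hQ]
    rw [lintegral_map hm1 hVm]
    rw [lintegral_map (f := fun x => ENNReal.ofReal (-Real.log (Q {V x}).toReal)) (hm1.comp hVm) measurable_fst]
  rw [hEnt]
  have hGm : Measurable (fun p : (ι → ℝ) × (ι → ℝ) => (Q {V p.1})⁻¹ * W {V p.1 - V p.2}) :=
    ((measurable_of_countable (fun z : κ → ℤ => (Q {z})⁻¹)).comp (hVm.comp measurable_fst)).mul
      ((measurable_of_countable (fun z : κ → ℤ => W {z})).comp
        ((hVm.comp measurable_fst).sub (hVm.comp measurable_snd)))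
  have hG := gibbs π ((π.map Prod.fst).prod (π.map Prod.snd))
    (fun p => -Real.log (Q {V p.1}).toReal) (fun p => β (V p.1 - V p.2))
    (fun p => neg_nonneg.2 (Real.log_nonpos ENNReal.toReal_nonneg (hle1 _)))
    (fun p => Finset.sum_nonneg fun j _ => add_nonneg (abs_nonneg _) hc0)
    ((measurable_of_countable (fun z : κ → ℤ => -Real.log (Q {z}).toReal)).comp
      (hVm.comp measurable_fst))
    ((measurable_of_countable β).comp ((hVm.comp measurable_fst).sub (hVm.comp measurable_snd)))
    (fun p => (Q {V p.1})⁻¹ * W {V p.1 - V p.2})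
    hGm ?_ ?_
  · refine hG.trans ?_
    rw [add_comm]
    refine add_le_add_right ?_ _
    calc ∫⁻ p, ENNReal.ofReal (β (V p.1 - V p.2)) ∂π
        ≤ ∫⁻ p, (ENNReal.ofReal ((m : ℝ) ^ 2) * ENNReal.ofReal (∑ i, (p.1 i - p.2 i) ^ 2)
            + ENNReal.ofReal (Fintype.card κ * (2 + c0))) ∂π := by
          refine lintegral_mono fun p => ?_
          rw [← ENNReal.ofReal_mul (by positivity), ← ENNReal.ofReal_add (by positivity) (by positivity)]
          refine ENNReal.ofReal_le_ofReal ?_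
          have h1 : ∑ j, (p.1 (e j) - p.2 (e j)) ^ 2 ≤ ∑ i, (p.1 i - p.2 i) ^ 2 := by
            refine (Finset.sum_map Finset.univ ⟨e, he⟩ (fun i => (p.1 i - p.2 i) ^ 2)).symm.le.trans ?_
            exact Finset.sum_le_sum_of_subset_of_nonneg (Finset.subset_univ _) (fun _ _ _ => sq_nonneg _)
          calc β (V p.1 - V p.2) ≤ ∑ j, (((m : ℝ) ^ 2 * (p.1 (e j) - p.2 (e j)) ^ 2 + 2) + c0) := by
                refine Finset.sum_le_sum fun j _ => ?_
                have := floor_bound m (p.1 (e j)) (p.2 (e j))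
                simp only [hV, Pi.sub_apply, Function.comp, Zq]
                linarith
            _ = (m : ℝ) ^ 2 * ∑ j, (p.1 (e j) - p.2 (e j)) ^ 2 + Fintype.card κ * (2 + c0) := by
                simp_rw [add_assoc]
                rw [Finset.sum_add_distrib, Finset.mul_sum]; simp [mul_add]
            _ ≤ _ := by gcongr
      _ ≤ _ := by
          rw [lintegral_add_right _ (by fun_prop), lintegral_const_mul _ (by fun_prop),
            ENNReal.ofReal_add (by positivity) (by positivity), ENNReal.ofReal_mul (p := (m : ℝ) ^ 2) (by positivity)]
          simp only [lintegral_const, measure_univ, mul_one]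
          gcongr
  · rw [lintegral_prod_symm _ hGm.aemeasurable]
    calc _ ≤ ∫⁻ y, 1 ∂(π.map Prod.snd) := by
          refine lintegral_mono fun y => ?_
          have : ∫⁻ x, (Q {V x})⁻¹ * W {V x - V y} ∂(π.map Prod.fst) =
              ∫⁻ z, (Q {z})⁻¹ * W {z - V y} ∂Q := by
            conv_rhs => rw [hQ]
            rw [lintegral_map (measurable_of_countable _) hVm]
          simp only
          rw [this, lintegral_countable']
          calc _ ≤ ∑' z, W {z - V y} := by
                refine ENNReal.tsum_le_tsum fun z => ?_
                rw [mul_right_comm]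
                exact mul_le_of_le_one_left' (ENNReal.inv_mul_le_one _)
            _ = 1 := by
                exact ((Equiv.subRight (V y)).tsum_eq (fun z => W {z})).trans (tsum_singleton W)
      _ = 1 := by simp
  · intro p
    rw [hWz, sub_eq_add_neg, Real.exp_add, ENNReal.ofReal_mul (Real.exp_pos _).le]
    gcongr
    by_cases h0 : Q {V p.1} = 0
    · simp [h0]
    · have : 0 < (Q {V p.1}).toReal := ENNReal.toReal_pos h0 (measure_ne_top _ _)
      rw [Real.exp_neg, Real.exp_log this, ENNReal.ofReal_inv_of_pos this,
        ENNReal.ofReal_toReal (measure_ne_top _ _)]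

lemma RD_le {ι : Type*} [Fintype ι] (ν : Measure (ι → ℝ)) [IsProbabilityMeasure ν] (D : ℝ)
    (π : Measure ((ι → ℝ) × (ι → ℝ))) [hπ : IsProbabilityMeasure π] (h1 : π.map Prod.fst = ν)
    (h2 : ∫⁻ p, ENNReal.ofReal (∑ i, (p.1 i - p.2 i) ^ 2) ∂π ≤ ENNReal.ofReal D)
    (q : Measure (ι → ℝ)) [IsProbabilityMeasure q] : RD ν D ≤ klDiv π (ν.prod q) := by
  unfold RD
  refine (iInf_le _ π).trans ((iInf_le _ hπ).trans ((iInf_le _ h1).trans ((iInf_le _ h2).trans ?_)))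
  have i2 : IsProbabilityMeasure (π.map Prod.snd) := Measure.isProbabilityMeasure_map (by fun_prop)
  rw [h1, KL_eq_klDiv]
  exact golden π ν q

lemma quant_err (m : ℕ) (hm : 1 ≤ m) (x : ℝ) : (x - (⌊(m : ℝ) * x⌋ : ℝ) / m) ^ 2 ≤ 1 / (m : ℝ) ^ 2 := by
  have hm0 : (0 : ℝ) < m := by positivity
  have h1 := Int.floor_le ((m : ℝ) * x)
  have h2 := Int.lt_floor_add_one ((m : ℝ) * x)
  have : x - (⌊(m : ℝ) * x⌋ : ℝ) / m = (m * x - ⌊(m : ℝ) * x⌋) / m := by field_simp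
  rw [this, div_pow]
  gcongr
  nlinarith

lemma klDiv_discrete {α T : Type*} [MeasurableSpace α] [MeasurableSpace T] [Countable T]
    [MeasurableSingletonClass T] (ν : Measure α) [IsProbabilityMeasure ν] (Z : α → T)
    (hZ : Measurable Z) :
    klDiv (ν.map (fun x => (x, Z x))) (ν.prod (ν.map Z)) ≤ Ent (ν.map Z) := by
  classical
  set Q := ν.map Z with hQ
  have iQ : IsProbabilityMeasure Q := Measure.isProbabilityMeasure_map hZ.aemeasurable
  by_cases hE : Ent Q = ⊤
  · simp [hE]
  have hg : Measurable (fun x => (x, Z x)) := measurable_id.prodMk hZ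
  have ig : IsProbabilityMeasure (ν.map (fun x => (x, Z x))) :=
    Measure.isProbabilityMeasure_map hg.aemeasurable
  have hQm : Measurable (fun z : T => (Q {z})⁻¹) := measurable_of_countable _
  have hS : MeasurableSet {p : α × T | Z p.1 = p.2} :=
    measurableSet_eq_fun (hZ.comp measurable_fst) measurable_snd
  set f : α × T → ℝ≥0∞ := fun p => if Z p.1 = p.2 then (Q {p.2})⁻¹ else 0 with hf
  have hfm : Measurable f := Measurable.ite hS (hQm.comp measurable_snd) measurable_const
  have hpos : ∀ᵐ x ∂ν, Q {Z x} ≠ 0 := by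
    have : ∀ᵐ z ∂Q, Q {z} ≠ 0 := by
      rw [ae_iff_of_countable]; exact fun z h => h
    exact ae_of_ae_map hZ.aemeasurable this
  have hdens : ν.map (fun x => (x, Z x)) = (ν.prod Q).withDensity f := by
    refine Measure.ext_of_lintegral _ fun h hh => ?_
    rw [lintegral_map hh hg, lintegral_withDensity_eq_lintegral_mul _ hfm hh,
      lintegral_prod _ (hfm.mul hh).aemeasurable]
    refine lintegral_congr_ae ?_
    filter_upwards [hpos] with x hx
    rw [lintegral_countable', tsum_eq_single (Z x)]
    · simp only [Pi.mul_apply, hf, if_true]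
      rw [mul_right_comm, ENNReal.inv_mul_cancel hx (measure_ne_top _ _), one_mul]
    · intro z hz
      simp [hf, hz.symm]
  have hle1 : ∀ z, (Q {z}).toReal ≤ 1 := fun z => by
    simpa using ENNReal.toReal_mono ENNReal.one_ne_top (prob_le_one (μ := Q) (s := {z}))
  have hnn : ∀ z, 0 ≤ -Real.log (Q {z}).toReal := fun z =>
    neg_nonneg.2 (Real.log_nonpos ENNReal.toReal_nonneg (hle1 _))
  have hm1 : Measurable fun z : T => -Real.log (Q {z}).toReal := measurable_of_countable _
  have hi0 : Integrable (fun z : T => -Real.log (Q {z}).toReal) Q := by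
    refine ⟨hm1.aestronglyMeasurable, ?_⟩
    rw [hasFiniteIntegral_iff_ofReal (Eventually.of_forall hnn)]
    exact lt_top_iff_ne_top.2 hE
  have hlf : ∀ x, Real.log (f (x, Z x)).toReal = -Real.log (Q {Z x}).toReal := by
    intro x
    simp [hf, ENNReal.toReal_inv, Real.log_inv]
  have hi1 : Integrable (fun x => -Real.log (Q {Z x}).toReal) ν := hi0.comp_measurable hZ
  have hlm : Measurable (fun p => Real.log (f p).toReal) := by fun_prop
  rw [KL_le_of_density _ _ f hfm hdens]
  · rw [integral_map hg.aemeasurable hlm.aestronglyMeasurable]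
    simp_rw [hlf]
    rw [← integral_map (f := fun z => -Real.log (Q {z}).toReal) hZ.aemeasurable
      hm1.aestronglyMeasurable, Ent,
      ofReal_integral_eq_lintegral_ofReal hi0 (Eventually.of_forall hnn)]
  · rw [integrable_map_measure hlm.aestronglyMeasurable hg.aemeasurable]
    refine hi1.congr (Eventually.of_forall fun x => (hlf x).symm)

lemma UB {ι : Type*} [Fintype ι] (ν : Measure (ι → ℝ)) [IsProbabilityMeasure ν] (m : ℕ) (hm : 1 ≤ m)
    (D : ℝ) (hD : (Fintype.card ι : ℝ) / (m : ℝ) ^ 2 ≤ D) : RD ν D ≤ Ent (ν.map (Zq m)) := by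
  set g : (ι → ℤ) → (ι → ℝ) := fun z i => (z i : ℝ) / m with hg
  have hgm : Measurable g := measurable_of_countable _
  have hZ := measurable_Zq (ι := ι) m
  have hZp : Measurable (fun x : ι → ℝ => (x, Zq m x)) := measurable_id.prodMk hZ
  have hGp : Measurable (Prod.map (id : (ι → ℝ) → (ι → ℝ)) g) := measurable_id.prodMap hgm
  have iQ : IsProbabilityMeasure (ν.map (Zq m)) := Measure.isProbabilityMeasure_map hZ.aemeasurable
  have iQ' : IsProbabilityMeasure ((ν.map (Zq m)).map g) :=
    Measure.isProbabilityMeasure_map hgm.aemeasurable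
  have i1 : IsProbabilityMeasure (ν.map (fun x => (x, Zq m x))) :=
    Measure.isProbabilityMeasure_map hZp.aemeasurable
  have i2 : IsProbabilityMeasure ((ν.map (fun x => (x, Zq m x))).map (Prod.map id g)) :=
    Measure.isProbabilityMeasure_map hGp.aemeasurable
  refine (RD_le ν D ((ν.map (fun x => (x, Zq m x))).map (Prod.map id g)) ?_ ?_ ((ν.map (Zq m)).map g)).trans ?_
  · rw [Measure.map_map measurable_fst hGp, Measure.map_map (measurable_fst.comp hGp) hZp]
    exact Measure.map_id
  · rw [lintegral_map (by fun_prop) hGp, lintegral_map (by fun_prop) hZp]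
    calc _ ≤ ∫⁻ x, ENNReal.ofReal D ∂ν := by
          refine lintegral_mono fun x => ENNReal.ofReal_le_ofReal (le_trans ?_ hD)
          calc _ ≤ ∑ i : ι, 1 / (m : ℝ) ^ 2 := Finset.sum_le_sum fun i _ => quant_err m hm (x i)
            _ = _ := by simp [div_eq_mul_inv]
      _ = _ := by simp
  · have : ν.prod ((ν.map (Zq m)).map g) = (ν.prod (ν.map (Zq m))).map (Prod.map id g) := by
      rw [← Measure.map_prod_map _ _ measurable_id hgm, Measure.map_id]
    rw [this]
    exact (klDiv_map_le _ _ hGp).trans (klDiv_discrete ν _ hZ)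

lemma marg {E A1 A2 : Type*} [MeasurableSpace E] [MeasurableSpace A1] [MeasurableSpace A2]
    (p1 : E → A1) (p2 : E → A2) (hp1 : Measurable p1) (hp2 : Measurable p2)
    (ν Q : Measure E) [IsProbabilityMeasure ν] [IsProbabilityMeasure Q]
    (Q1 : Measure A1) (Q2 : Measure A2) [IsProbabilityMeasure Q1] [IsProbabilityMeasure Q2]
    (hQ : Q.map (fun y => (p1 y, p2 y)) = Q1.prod Q2)
    (f1 : A1 × A1 → ℝ≥0∞) (f2 : A2 × A2 → ℝ≥0∞) (hf1 : Measurable f1) (hf2 : Measurable f2)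
    (h2 : ∀ᵐ x ∂ν, ∫⁻ y, f2 (p2 x, y) ∂Q2 = 1) :
    ((ν.prod Q).withDensity (fun p => f1 (p1 p.1, p1 p.2) * f2 (p2 p.1, p2 p.2))).map
      (Prod.map p1 p1) = ((ν.map p1).prod Q1).withDensity f1 := by
  have hF : Measurable (fun p : E × E => f1 (p1 p.1, p1 p.2) * f2 (p2 p.1, p2 p.2)) := by fun_prop
  have i1 : IsProbabilityMeasure (ν.map p1) := Measure.isProbabilityMeasure_map hp1.aemeasurable
  refine Measure.ext_of_lintegral _ fun h hh => ?_
  have hhp : Measurable (fun p : E × E => h (Prod.map p1 p1 p)) := hh.comp (hp1.prodMap hp1)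
  rw [lintegral_map hh (hp1.prodMap hp1), lintegral_withDensity_eq_lintegral_mul _ hF hhp,
    lintegral_prod _ (hF.mul hhp).aemeasurable, lintegral_withDensity_eq_lintegral_mul _ hf1 hh,
    lintegral_prod _ (hf1.mul hh).aemeasurable, lintegral_map (hf1.mul hh).lintegral_prod_right' hp1]
  refine lintegral_congr_ae ?_
  filter_upwards [h2] with x hx
  have hk : Measurable (fun y : A1 × A2 => (f1 (p1 x, y.1) * h (p1 x, y.1)) * f2 (p2 x, y.2)) := by
    fun_prop
  calc _ = ∫⁻ y, (fun y : A1 × A2 => (f1 (p1 x, y.1) * h (p1 x, y.1)) * f2 (p2 x, y.2)) (p1 y, p2 y) ∂Q := by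
        refine lintegral_congr fun y => ?_
        simp only [Pi.mul_apply, Prod.map]
        ring
    _ = ∫⁻ y, (f1 (p1 x, y.1) * h (p1 x, y.1)) * f2 (p2 x, y.2) ∂(Q1.prod Q2) := by
        rw [← hQ, lintegral_map hk (hp1.prodMk hp2)]
    _ = _ := by
        rw [lintegral_prod_mul (f := fun y => f1 (p1 x, y) * h (p1 x, y)) (g := fun y => f2 (p2 x, y))
          (by fun_prop) (by fun_prop), hx, mul_one]
        rfl

lemma dens_one {A B : Type*} [MeasurableSpace A] [MeasurableSpace B] (P : Measure A) (Q : Measure B)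
    [IsProbabilityMeasure P] [IsProbabilityMeasure Q] (f : A × B → ℝ≥0∞) (hf : Measurable f)
    (h : ((P.prod Q).withDensity f).map Prod.fst = P) : ∀ᵐ x ∂P, ∫⁻ y, f (x, y) ∂Q = 1 := by
  have hm : Measurable (fun x => ∫⁻ y, f (x, y) ∂Q) := hf.lintegral_prod_right'
  have : P.withDensity (fun x => ∫⁻ y, f (x, y) ∂Q) = P.withDensity 1 := by
    rw [withDensity_one]
    conv_rhs => rw [← h]
    refine Measure.ext_of_lintegral _ fun k hk => ?_
    have hk' : Measurable (fun p : A × B => k p.1) := hk.comp measurable_fst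
    rw [lintegral_withDensity_eq_lintegral_mul _ hm hk, lintegral_map hk measurable_fst,
      lintegral_withDensity_eq_lintegral_mul _ hf hk',
      lintegral_prod _ (hf.mul hk').aemeasurable]
    refine lintegral_congr fun x => ?_
    simp only [Pi.mul_apply]
    rw [lintegral_mul_const _ (by fun_prop)]
  exact (withDensity_eq_iff_of_sigmaFinite hm.aemeasurable measurable_one.aemeasurable).1 this

lemma le_RD {ι : Type*} [Fintype ι] (ν : Measure (ι → ℝ)) (D : ℝ) (x : ℝ≥0∞)
    (h : ∀ (π : Measure ((ι → ℝ) × (ι → ℝ))), IsProbabilityMeasure π → π.map Prod.fst = ν →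
      ∫⁻ p, ENNReal.ofReal (∑ i, (p.1 i - p.2 i) ^ 2) ∂π ≤ ENNReal.ofReal D →
      x ≤ KL π ((π.map Prod.fst).prod (π.map Prod.snd))) : x ≤ RD ν D :=
  le_iInf fun π => le_iInf fun h1 => le_iInf fun h2 => le_iInf fun h3 => h π h1 h2 h3

lemma subadd {α β γ : Type*} [Fintype α] [Fintype β] [Fintype γ] (e : α ⊕ β ≃ γ)
    (ν : Measure (γ → ℝ)) [IsProbabilityMeasure ν] (D1 D2 : ℝ) (hD1 : 0 ≤ D1) (hD2 : 0 ≤ D2) :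
    RD ν (D1 + D2) ≤ RD (ν.map (fun x i => x (e (Sum.inl i)))) D1
      + RD (ν.map (fun x i => x (e (Sum.inr i)))) D2 := by
  set p1 : (γ → ℝ) → (α → ℝ) := fun x i => x (e (Sum.inl i)) with hp1
  set p2 : (γ → ℝ) → (β → ℝ) := fun x i => x (e (Sum.inr i)) with hp2
  have hp1m : Measurable p1 := by fun_prop
  have hp2m : Measurable p2 := by fun_prop
  rw [← tsub_le_iff_right]
  refine le_RD _ _ _ fun π1 hπ1 hfst1 hdist1 => ?_
  rw [tsub_le_iff_left, ← tsub_le_iff_right]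
  refine le_RD _ _ _ fun π2 hπ2 hfst2 hdist2 => ?_
  rw [tsub_le_iff_left]
  have iP1 : IsProbabilityMeasure (ν.map p1) := Measure.isProbabilityMeasure_map hp1m.aemeasurable
  have iP2 : IsProbabilityMeasure (ν.map p2) := Measure.isProbabilityMeasure_map hp2m.aemeasurable
  rw [hfst1, hfst2]
  set Q1 := π1.map Prod.snd with hQ1
  set Q2 := π2.map Prod.snd with hQ2
  have iQ1 : IsProbabilityMeasure Q1 := Measure.isProbabilityMeasure_map (by fun_prop)
  have iQ2 : IsProbabilityMeasure Q2 := Measure.isProbabilityMeasure_map (by fun_prop)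
  rw [KL_eq_klDiv, KL_eq_klDiv]
  by_cases hk1 : klDiv π1 ((ν.map p1).prod Q1) = ⊤
  · simp [hk1]
  by_cases hk2 : klDiv π2 ((ν.map p2).prod Q2) = ⊤
  · simp [hk2]
  obtain ⟨ac1, hi1⟩ := klDiv_ne_top_iff.1 hk1
  obtain ⟨ac2, hi2⟩ := klDiv_ne_top_iff.1 hk2
  set f1 := π1.rnDeriv ((ν.map p1).prod Q1) with hf1
  set f2 := π2.rnDeriv ((ν.map p2).prod Q2) with hf2
  have hf1m : Measurable f1 := Measure.measurable_rnDeriv _ _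
  have hf2m : Measurable f2 := Measure.measurable_rnDeriv _ _
  have hw1 : ((ν.map p1).prod Q1).withDensity f1 = π1 := Measure.withDensity_rnDeriv_eq _ _ ac1
  have hw2 : ((ν.map p2).prod Q2).withDensity f2 = π2 := Measure.withDensity_rnDeriv_eq _ _ ac2
  have h1 : ∀ᵐ x ∂ν, ∫⁻ y, f1 (p1 x, y) ∂Q1 = 1 :=
    ae_of_ae_map hp1m.aemeasurable (dens_one _ _ f1 hf1m (by rw [hw1, hfst1]))
  have h2 : ∀ᵐ x ∂ν, ∫⁻ y, f2 (p2 x, y) ∂Q2 = 1 :=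
    ae_of_ae_map hp2m.aemeasurable (dens_one _ _ f2 hf2m (by rw [hw2, hfst2]))
  let c : (α → ℝ) × (β → ℝ) → (γ → ℝ) := fun y g => Sum.elim y.1 y.2 (e.symm g)
  have hcm : Measurable c := by
    refine measurable_pi_lambda _ fun g => ?_
    rcases h : e.symm g with i | i
    · simp only [c, h, Sum.elim_inl]; fun_prop
    · simp only [c, h, Sum.elim_inr]; fun_prop
  set Q := (Q1.prod Q2).map c with hQdef
  have iQ : IsProbabilityMeasure Q := Measure.isProbabilityMeasure_map hcm.aemeasurable
  have hQ12 : Q.map (fun y => (p1 y, p2 y)) = Q1.prod Q2 := by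
    rw [hQdef, Measure.map_map (hp1m.prodMk hp2m) hcm]
    have : (fun y => (p1 y, p2 y)) ∘ c = id := by
      funext y
      simp [c, hp1, hp2]
    rw [this, Measure.map_id]
  have hQ21 : Q.map (fun y => (p2 y, p1 y)) = Q2.prod Q1 := by
    rw [← Measure.prod_swap (μ := Q1) (ν := Q2), ← hQ12, Measure.map_map measurable_swap (hp1m.prodMk hp2m)]
    rfl
  set F : (γ → ℝ) × (γ → ℝ) → ℝ≥0∞ := fun p => f1 (p1 p.1, p1 p.2) * f2 (p2 p.1, p2 p.2) with hF
  have hFm : Measurable F := by fun_prop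
  set π := (ν.prod Q).withDensity F with hπ
  have m1 : π.map (Prod.map p1 p1) = π1 := by
    rw [← hw1]; exact marg p1 p2 hp1m hp2m ν Q Q1 Q2 hQ12 f1 f2 hf1m hf2m h2
  have m2 : π.map (Prod.map p2 p2) = π2 := by
    rw [← hw2, ← marg p2 p1 hp2m hp1m ν Q Q2 Q1 hQ21 f2 f1 hf2m hf1m h1, hπ, hF]
    simp_rw [mul_comm]
  have m0 : π.map Prod.fst = ν := by
    refine Measure.ext_of_lintegral _ fun h hh => ?_
    have hh' : Measurable (fun p : (γ → ℝ) × (γ → ℝ) => h p.1) := hh.comp measurable_fst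
    rw [lintegral_map hh measurable_fst, hπ, lintegral_withDensity_eq_lintegral_mul _ hFm
      hh', lintegral_prod _ (hFm.mul hh').aemeasurable]
    refine lintegral_congr_ae ?_
    filter_upwards [h1, h2] with x hx1 hx2
    simp only [Pi.mul_apply]
    rw [lintegral_mul_const _ (by fun_prop)]
    have : ∫⁻ y, F (x, y) ∂Q = 1 := by
      calc _ = ∫⁻ y, f1 (p1 x, y.1) * f2 (p2 x, y.2) ∂(Q1.prod Q2) := by
            rw [← hQ12, lintegral_map (by fun_prop) (hp1m.prodMk hp2m)]
        _ = 1 := by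
            rw [lintegral_prod_mul (f := fun y => f1 (p1 x, y)) (g := fun y => f2 (p2 x, y))
              (by fun_prop) (by fun_prop), hx1, hx2, mul_one]
    rw [this, one_mul]
  have iπ : IsProbabilityMeasure π := by
    refine ⟨?_⟩
    have : (π.map Prod.fst) univ = 1 := by rw [m0]; exact measure_univ
    rwa [Measure.map_apply measurable_fst MeasurableSet.univ, preimage_univ] at this
  have pm1 : Measurable (Prod.map p1 p1) := hp1m.prodMap hp1m
  have pm2 : Measurable (Prod.map p2 p2) := hp2m.prodMap hp2m
  refine (RD_le ν (D1 + D2) π m0 ?_ Q).trans ?_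
  · calc _ = ∫⁻ p, (ENNReal.ofReal (∑ i, ((Prod.map p1 p1 p).1 i - (Prod.map p1 p1 p).2 i) ^ 2)
          + ENNReal.ofReal (∑ i, ((Prod.map p2 p2 p).1 i - (Prod.map p2 p2 p).2 i) ^ 2)) ∂π := by
          refine lintegral_congr fun p => ?_
          rw [← ENNReal.ofReal_add (Finset.sum_nonneg fun _ _ => sq_nonneg _)
            (Finset.sum_nonneg fun _ _ => sq_nonneg _), ← e.sum_comp, Fintype.sum_sum_type]
          rfl
      _ = ∫⁻ p, ENNReal.ofReal (∑ i, (p.1 i - p.2 i) ^ 2) ∂π1 +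
          ∫⁻ p, ENNReal.ofReal (∑ i, (p.1 i - p.2 i) ^ 2) ∂π2 := by
          rw [lintegral_add_left (by fun_prop)]
          conv_rhs => rw [← m1, ← m2]
          rw [lintegral_map (by fun_prop) pm1, lintegral_map (by fun_prop) pm2]
      _ ≤ _ := by
          rw [ENNReal.ofReal_add hD1 hD2]
          exact add_le_add hdist1 hdist2
  · have q1 : ∀ᵐ p ∂π, 0 < f1 (Prod.map p1 p1 p) ∧ f1 (Prod.map p1 p1 p) < ⊤ := by
      have : ∀ᵐ p ∂π1, 0 < f1 p ∧ f1 p < ⊤ := by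
        filter_upwards [Measure.rnDeriv_pos ac1, ac1 (Measure.rnDeriv_lt_top π1 _)] with p a b
        exact ⟨a, b⟩
      rw [← m1] at this
      exact ae_of_ae_map pm1.aemeasurable this
    have q2 : ∀ᵐ p ∂π, 0 < f2 (Prod.map p2 p2 p) ∧ f2 (Prod.map p2 p2 p) < ⊤ := by
      have : ∀ᵐ p ∂π2, 0 < f2 p ∧ f2 p < ⊤ := by
        filter_upwards [Measure.rnDeriv_pos ac2, ac2 (Measure.rnDeriv_lt_top π2 _)] with p a b
        exact ⟨a, b⟩
      rw [← m2] at this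
      exact ae_of_ae_map pm2.aemeasurable this
    have hlog : (fun p => Real.log (F p).toReal) =ᵐ[π] fun p =>
        llr π1 ((ν.map p1).prod Q1) (Prod.map p1 p1 p) + llr π2 ((ν.map p2).prod Q2) (Prod.map p2 p2 p) := by
      filter_upwards [q1, q2] with p a b
      have a' := (ENNReal.toReal_pos a.1.ne' a.2.ne).ne'
      have b' := (ENNReal.toReal_pos b.1.ne' b.2.ne).ne'
      simp only [llr, hF]
      rw [ENNReal.toReal_mul]
      exact Real.log_mul a' b'
    have l1 : Measurable (llr π1 ((ν.map p1).prod Q1)) := measurable_llr _ _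
    have l2 : Measurable (llr π2 ((ν.map p2).prod Q2)) := measurable_llr _ _
    have j1 : Integrable (fun p => llr π1 ((ν.map p1).prod Q1) (Prod.map p1 p1 p)) π := by
      refine Integrable.comp_measurable (f := Prod.map p1 p1) (g := llr π1 ((ν.map p1).prod Q1)) ?_ pm1
      rw [m1]; exact hi1
    have j2 : Integrable (fun p => llr π2 ((ν.map p2).prod Q2) (Prod.map p2 p2 p)) π := by
      refine Integrable.comp_measurable (f := Prod.map p2 p2) (g := llr π2 ((ν.map p2).prod Q2)) ?_ pm2
      rw [m2]; exact hi2
    rw [KL_le_of_density π _ F hFm hπ ((j1.add j2).congr hlog.symm), integral_congr_ae hlog,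
      integral_add j1 j2]
    refine ENNReal.ofReal_add_le.trans (le_of_eq ?_)
    rw [klDiv_of_ac_of_integrable ac1 hi1, klDiv_of_ac_of_integrable ac2 hi2]
    simp only [probReal_univ, add_sub_cancel_right]
    have t1 := integral_map (μ := π) pm1.aemeasurable (f := llr π1 ((ν.map p1).prod Q1)) l1.aestronglyMeasurable
    have t2 := integral_map (μ := π) pm2.aemeasurable (f := llr π2 ((ν.map p2).prod Q2)) l2.aestronglyMeasurable
    rw [m1] at t1
    rw [m2] at t2
    rw [t1, t2]

lemma fekete (u : ℕ → ℝ≥0∞) (hsub : ∀ k l, u (k + l) ≤ u k + u l)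
    (hfin : ∀ k, u (k + 1) ≠ ⊤ → u 1 ≠ ⊤) :
    Tendsto (fun k : ℕ => u (k + 1) / ((k : ℝ≥0∞) + 1)) atTop
      (nhds (⨅ k : ℕ, u (k + 1) / ((k : ℝ≥0∞) + 1))) := by
  by_cases h1 : u 1 = ⊤
  · have : ∀ k : ℕ, u (k + 1) / ((k : ℝ≥0∞) + 1) = ⊤ := by
      intro k
      have : u (k + 1) = ⊤ := by
        by_contra h; exact hfin k h h1
      rw [this, ENNReal.top_div_of_ne_top (by simp)]
    simp_rw [this]
    simp
  have hall : ∀ k, u (k + 1) ≠ ⊤ := by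
    intro k
    induction k with
    | zero => exact h1
    | succ k ih =>
      exact ne_top_of_le_ne_top (ENNReal.add_ne_top.2 ⟨ih, h1⟩) (hsub (k + 1) 1)
  let v : ℕ → ℝ := fun n => if n = 0 then 0 else (u n).toReal
  have hv : ∀ k, v (k + 1) = (u (k + 1)).toReal := fun k => by simp [v]
  have hvs : Subadditive v := by
    intro k l
    rcases k with _ | k
    · simp [v]
    rcases l with _ | l
    · simp [v]
    have : k + 1 + (l + 1) = (k + 1 + l) + 1 := by ring
    rw [hv, hv, this, hv, ← this, ← ENNReal.toReal_add (hall k) (hall l)]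
    exact ENNReal.toReal_mono (ENNReal.add_ne_top.2 ⟨hall k, hall l⟩) (hsub _ _)
  have hv0 : ∀ n, 0 ≤ v n := by
    intro n; simp only [v]; split_ifs <;> simp
  have hb : BddBelow (range fun n => v n / n) := by
    refine ⟨0, ?_⟩
    rintro _ ⟨n, rfl⟩
    exact div_nonneg (hv0 n) (by positivity)
  have ht := hvs.tendsto_lim hb
  have ht' := (tendsto_add_atTop_iff_nat 1).2 ht
  have ht2 := ENNReal.tendsto_ofReal ht'
  have heq : ∀ k : ℕ, ENNReal.ofReal (v (k + 1) / ((k + 1 : ℕ) : ℝ)) = u (k + 1) / ((k : ℝ≥0∞) + 1) := by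
    intro k
    rw [ENNReal.ofReal_div_of_pos (by positivity), hv, ENNReal.ofReal_toReal (hall k),
      ENNReal.ofReal_natCast]
    push_cast; rfl
  simp_rw [heq] at ht2
  have : ENNReal.ofReal hvs.lim = ⨅ k : ℕ, u (k + 1) / ((k : ℝ≥0∞) + 1) := by
    apply le_antisymm
    · refine le_iInf fun k => ?_
      rw [← heq]
      exact ENNReal.ofReal_le_ofReal (hvs.lim_le_div hb (Nat.succ_ne_zero k))
    · exact ge_of_tendsto' ht2 fun k => iInf_le _ k
  rw [← this]
  exact ht2

lemma lim_tool {α : Type*} {l : Filter α} [l.NeBot] (f g : α → ℝ≥0∞) (c d : α → ℝ)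
    (hc : Tendsto c l (nhds 1)) (hd : Tendsto d l (nhds 0))
    (h : ∀ᶠ x in l, f x ≤ ENNReal.ofReal (c x) * g x + ENNReal.ofReal (d x)) :
    limsup f l ≤ limsup g l ∧ liminf f l ≤ liminf g l := by
  have key : ∀ y : ℝ≥0∞, Tendsto (fun ε : ℝ => ENNReal.ofReal (1 + ε) * y + ENNReal.ofReal ε)
      (nhdsWithin 0 (Ioi 0)) (nhds y) := by
    intro y
    have t0 : Tendsto (fun ε : ℝ => ε) (nhdsWithin 0 (Ioi 0)) (nhds 0) := tendsto_nhdsWithin_of_tendsto_nhds tendsto_id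
    have t1 : Tendsto (fun ε : ℝ => ENNReal.ofReal (1 + ε)) (nhdsWithin 0 (Ioi 0)) (nhds 1) := by
      have := ENNReal.tendsto_ofReal (t0.const_add 1)
      simpa using this
    have t2 := ENNReal.tendsto_ofReal t0
    have := (ENNReal.Tendsto.mul_const (b := y) t1 (Or.inl one_ne_zero)).add t2
    simpa using this
  have ev : ∀ ε : ℝ, 0 < ε → ∀ᶠ x in l, f x ≤ ENNReal.ofReal (1 + ε) * g x + ENNReal.ofReal ε := by
    intro ε hε
    filter_upwards [h, hc.eventually_le_const (by linarith : (1 : ℝ) < 1 + ε),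
      hd.eventually_le_const hε] with x h1 h2 h3
    refine h1.trans ?_
    gcongr
  have mono : ∀ ε : ℝ, Monotone (fun y : ℝ≥0∞ => ENNReal.ofReal (1 + ε) * y + ENNReal.ofReal ε) := by
    intro ε a b hab
    simp only
    gcongr
  have cont : ∀ ε : ℝ, Continuous (fun y : ℝ≥0∞ => ENNReal.ofReal (1 + ε) * y + ENNReal.ofReal ε) := by
    intro ε
    exact (ENNReal.continuous_const_mul ENNReal.ofReal_ne_top).add continuous_const
  constructor
  · refine ge_of_tendsto (key _) ?_
    filter_upwards [self_mem_nhdsWithin] with ε hε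
    have := (mono ε).map_limsup_of_continuousAt (F := l) g (cont ε).continuousAt
    refine (limsup_le_limsup (ev ε hε)).trans ?_
    exact this.ge
  · refine ge_of_tendsto (key _) ?_
    filter_upwards [self_mem_nhdsWithin] with ε hε
    have := (mono ε).map_liminf_of_continuousAt (F := l) g (cont ε).continuousAt
    refine (liminf_le_liminf (ev ε hε)).trans ?_
    exact this.ge

lemma div_tool (x : ℝ≥0∞) (p q c : ℝ) (hp : 0 < p) (hq : 0 < q) (h : q ≤ c * p) :
    x / ENNReal.ofReal p ≤ ENNReal.ofReal c * (x / ENNReal.ofReal q) := by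
  have hc : 0 ≤ c := by
    by_contra hc; nlinarith
  rw [div_eq_mul_inv, div_eq_mul_inv, ← ENNReal.ofReal_inv_of_pos hp, ← ENNReal.ofReal_inv_of_pos hq,
    mul_left_comm, ← ENNReal.ofReal_mul hc]
  gcongr
  rw [inv_eq_one_div, ← div_eq_mul_inv, div_le_div_iff₀ hp hq]
  linarith

lemma two_mul_div (x : ℝ≥0∞) (s : ℝ) :
    2 * (x / ENNReal.ofReal s) = x / ENNReal.ofReal (s / 2) := by
  rw [ENNReal.ofReal_div_of_pos two_pos, div_eq_mul_inv, div_eq_mul_inv, div_eq_mul_inv,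
    ENNReal.mul_inv (Or.inr (by simp)) (Or.inr (by simp)), inv_inv]
  simp only [ENNReal.ofReal_ofNat]
  ring

lemma lim_ratio (a : ℝ) : Tendsto (fun s : ℝ => s / (s - a)) atTop (nhds 1) := by
  have h1 : Tendsto (fun s : ℝ => a / (s - a)) atTop (nhds 0) :=
    (tendsto_atTop_add_const_right _ (-a) tendsto_id).const_div_atTop a
  have h2 := h1.const_add 1
  rw [add_zero] at h2
  refine h2.congr' ?_
  filter_upwards [eventually_gt_atTop a] with s hs
  have : s - a ≠ 0 := by linarith
  field_simp
  ring

lemma asymp (h : ℕ → ℝ≥0∞) (r : ℝ → ℝ≥0∞) (C K : ℝ) (hC : 0 ≤ C) (hK : 1 ≤ K)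
    (hr : ∀ D D', 0 < D → D ≤ D' → r D' ≤ r D)
    (hA : ∀ m : ℕ, 1 ≤ m → h m ≤ r (1 / (m : ℝ) ^ 2) + ENNReal.ofReal C)
    (hB : ∀ m : ℕ, 1 ≤ m → r (K / (m : ℝ) ^ 2) ≤ h m) :
    limsup (fun m : ℕ => h m / ENNReal.ofReal (Real.log m)) atTop =
      2 * limsup (fun D : ℝ => r D / ENNReal.ofReal (-Real.log D)) (nhdsWithin 0 (Ioi 0)) ∧
    liminf (fun m : ℕ => h m / ENNReal.ofReal (Real.log m)) atTop =
      2 * liminf (fun D : ℝ => r D / ENNReal.ofReal (-Real.log D)) (nhdsWithin 0 (Ioi 0)) := by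
  have mono2 : Monotone (fun y : ℝ≥0∞ => 2 * y) := fun a b hab => by simp only; gcongr
  have cont2 : Continuous (fun y : ℝ≥0∞ => 2 * y) := ENNReal.continuous_const_mul (by simp)
  rw [mono2.map_limsup_of_continuousAt _ cont2.continuousAt,
    mono2.map_liminf_of_continuousAt _ cont2.continuousAt]
  have e2 : (fun y : ℝ≥0∞ => 2 * y) ∘ (fun D : ℝ => r D / ENNReal.ofReal (-Real.log D)) =
      fun D : ℝ => r D / ENNReal.ofReal (-Real.log D / 2) := by
    funext D; exact two_mul_div _ _
  rw [e2]
  set G : ℝ → ℝ≥0∞ := fun D => r D / ENNReal.ofReal (-Real.log D / 2) with hG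
  set H : ℕ → ℝ≥0∞ := fun m => h m / ENNReal.ofReal (Real.log m) with hH
  have hlogm : Tendsto (fun m : ℕ => Real.log m) atTop atTop :=
    Real.tendsto_log_atTop.comp tendsto_natCast_atTop_atTop
  have hseq : ∀ A : ℝ, 0 < A → Tendsto (fun m : ℕ => A / (m : ℝ) ^ 2) atTop (nhdsWithin 0 (Ioi 0)) := by
    intro A hA
    refine tendsto_nhdsWithin_iff.2 ⟨?_, ?_⟩
    · exact ((tendsto_pow_atTop two_ne_zero).comp tendsto_natCast_atTop_atTop).const_div_atTop A
    · filter_upwards [eventually_ge_atTop 1] with m hm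
      have : (0 : ℝ) < m := by positivity
      exact mem_Ioi.2 (by positivity)
  have hlogD : Tendsto (fun D : ℝ => -Real.log D) (nhdsWithin 0 (Ioi 0)) atTop :=
    tendsto_neg_atBot_atTop.comp Real.tendsto_log_nhdsGT_zero
  have hlogsq : ∀ (A : ℝ) (m : ℕ), 0 < A → 1 ≤ m →
      -Real.log (A / (m : ℝ) ^ 2) / 2 = Real.log m - Real.log A / 2 := by
    intro A m hA hm
    have : (m : ℝ) ≠ 0 := by positivity
    rw [Real.log_div hA.ne' (by positivity), Real.log_pow]
    push_cast; ring
  have hD1 : ∀ᶠ D : ℝ in nhdsWithin 0 (Ioi 0), 0 < D := self_mem_nhdsWithin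
  -- first
  have S1 : limsup H atTop ≤ limsup G (nhdsWithin 0 (Ioi 0)) := by
    have t := lim_tool (l := atTop) H (fun m : ℕ => G (1 / (m : ℝ) ^ 2)) (fun _ => 1)
      (fun m => C / Real.log m) tendsto_const_nhds (hlogm.const_div_atTop C) ?_
    · refine t.1.trans ?_
      exact limsup_le_limsup_of_le (f := map (fun m : ℕ => 1 / (m : ℝ) ^ 2) atTop) (hseq 1 one_pos)
    · filter_upwards [eventually_ge_atTop 1, hlogm.eventually_gt_atTop 0] with m hm hl
      simp only [hH, hG]
      rw [hlogsq 1 m one_pos hm, ENNReal.ofReal_one, one_mul, Real.log_one, zero_div, sub_zero,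
        ENNReal.ofReal_div_of_pos hl, ← ENNReal.add_div]
      exact ENNReal.div_le_div_right (hA m hm) _
  have S4 : liminf G (nhdsWithin 0 (Ioi 0)) ≤ liminf H atTop := by
    have t := lim_tool (l := atTop) (fun m : ℕ => G (K / (m : ℝ) ^ 2)) H
      (fun m => Real.log m / (Real.log m - Real.log K / 2)) (fun _ => 0)
      ((lim_ratio (Real.log K / 2)).comp hlogm) tendsto_const_nhds ?_
    · refine le_trans ?_ t.2
      exact liminf_le_liminf_of_le (g := map (fun m : ℕ => K / (m : ℝ) ^ 2) atTop) (hseq K (by linarith))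
    · filter_upwards [eventually_ge_atTop 1, hlogm.eventually_gt_atTop 0,
        hlogm.eventually_gt_atTop (Real.log K / 2)] with m hm hl hl2
      simp only [hH, hG]
      rw [hlogsq K m (by linarith) hm, ENNReal.ofReal_zero, add_zero]
      refine (ENNReal.div_le_div_right (hB m hm) _).trans ?_
      have hpos : 0 < Real.log m - Real.log K / 2 := by linarith
      refine div_tool _ _ _ _ hpos hl ?_
      rw [div_mul_cancel₀ _ hpos.ne']
  have hsq : ∀ A : ℝ, 0 < A → Tendsto (fun D : ℝ => Real.sqrt (A / D)) (nhdsWithin 0 (Ioi 0)) atTop := by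
    intro A hA
    have h1 : Tendsto (fun D : ℝ => A * D⁻¹) (nhdsWithin 0 (Ioi 0)) atTop :=
      tendsto_inv_nhdsGT_zero.const_mul_atTop hA
    have h2 : (fun D : ℝ => A / D) = fun D : ℝ => A * D⁻¹ := by
      funext D; rw [div_eq_mul_inv]
    rw [← h2] at h1
    exact Real.tendsto_sqrt_atTop.comp h1
  have hlsq : ∀ A D : ℝ, 0 < A → 0 < D → Real.log (Real.sqrt (A / D)) = Real.log A / 2 + -Real.log D / 2 := by
    intro A D hA hD
    rw [Real.log_sqrt (by positivity), Real.log_div hA.ne' hD.ne']; ring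
  have S2 : limsup G (nhdsWithin 0 (Ioi 0)) ≤ limsup H atTop := by
    have hm := tendsto_nat_ceil_atTop.comp (hsq K (by linarith))
    have t := lim_tool (l := nhdsWithin 0 (Ioi 0)) G (fun D : ℝ => H ⌈Real.sqrt (K / D)⌉₊)
      (fun D => 1 + (Real.log K + 2 * Real.log 2) / (-Real.log D)) (fun _ => 0)
      (by simpa using (hlogD.const_div_atTop (Real.log K + 2 * Real.log 2)).const_add 1)
      tendsto_const_nhds ?_
    · refine t.1.trans ?_
      exact limsup_le_limsup_of_le (f := map (fun D : ℝ => ⌈Real.sqrt (K / D)⌉₊) (nhdsWithin 0 (Ioi 0))) hm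
    · filter_upwards [hD1, hlogD.eventually_gt_atTop 0, hm.eventually_ge_atTop 2,
        (hsq K (by linarith)).eventually_ge_atTop 1] with D hD hl hm2 hs1
      simp only [Function.comp] at hm2
      set m := ⌈Real.sqrt (K / D)⌉₊ with hmdef
      have hm2' : (2 : ℝ) ≤ m := by exact_mod_cast hm2
      have hc1 : Real.sqrt (K / D) ≤ m := Nat.le_ceil _
      have hc2 : (m : ℝ) < Real.sqrt (K / D) + 1 := Nat.ceil_lt_add_one (Real.sqrt_nonneg _)
      have hKD : K / (m : ℝ) ^ 2 ≤ D := by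
        have h3 : K / D ≤ (m : ℝ) ^ 2 := Real.sqrt_le_iff.1 hc1 |>.2
        rw [div_le_iff₀ (by positivity)]
        rw [div_le_iff₀ hD] at h3
        linarith
      have hrh : r D ≤ h m := (hr _ _ (by positivity) hKD).trans (hB m (by omega))
      have hlm : Real.log m ≤ Real.log 2 + (Real.log K / 2 + -Real.log D / 2) := by
        rw [← hlsq K D (by linarith) hD, ← Real.log_mul two_ne_zero (by positivity)]
        exact Real.log_le_log (by positivity) (by linarith)
      rw [ENNReal.ofReal_zero, add_zero]
      simp only [hG, hH]
      refine (ENNReal.div_le_div_right hrh _).trans ?_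
      refine div_tool _ _ _ _ (by linarith) (Real.log_pos (by linarith)) ?_
      have : (1 + (Real.log K + 2 * Real.log 2) / (-Real.log D)) * (-Real.log D / 2) =
        Real.log 2 + (Real.log K / 2 + -Real.log D / 2) := by
        have : Real.log D ≠ 0 := by linarith
        field_simp; ring
      rw [this]; exact hlm
  have S3 : liminf H atTop ≤ liminf G (nhdsWithin 0 (Ioi 0)) := by
    have hm := tendsto_nat_floor_atTop.comp (hsq 1 one_pos)
    have hlogm' := hlogm.comp hm
    have hlogD2 : Tendsto (fun D : ℝ => -Real.log D / 2) (nhdsWithin 0 (Ioi 0)) atTop :=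
      hlogD.atTop_div_const two_pos
    have t := lim_tool (l := nhdsWithin 0 (Ioi 0)) (fun D : ℝ => H ⌊Real.sqrt (1 / D)⌋₊) G
      (fun D => (-Real.log D / 2) / (-Real.log D / 2 - Real.log 2))
      (fun D => C / Real.log ⌊Real.sqrt (1 / D)⌋₊)
      ((lim_ratio (Real.log 2)).comp hlogD2)
      (hlogm'.const_div_atTop C) ?_
    · refine le_trans ?_ t.2
      exact liminf_le_liminf_of_le (g := map (fun D : ℝ => ⌊Real.sqrt (1 / D)⌋₊) (nhdsWithin 0 (Ioi 0))) hm
    · filter_upwards [hD1, hlogD2.eventually_gt_atTop (Real.log 2), hm.eventually_ge_atTop 2] with D hD hl hm2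
      simp only [Function.comp] at hm2
      set m := ⌊Real.sqrt (1 / D)⌋₊ with hmdef
      have hm2' : (2 : ℝ) ≤ m := by exact_mod_cast hm2
      have hc1 : (m : ℝ) ≤ Real.sqrt (1 / D) := Nat.floor_le (Real.sqrt_nonneg _)
      have hc2 : Real.sqrt (1 / D) < m + 1 := Nat.lt_floor_add_one _
      have hKD : D ≤ 1 / (m : ℝ) ^ 2 := by
        have h3 : (m : ℝ) ^ 2 ≤ 1 / D := (Real.le_sqrt' (by linarith)).1 hc1
        rw [le_div_iff₀ (by positivity)]
        rw [le_div_iff₀ hD] at h3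
        linarith
      have hl2 : 0 < Real.log 2 := Real.log_pos (by norm_num)
      have hlm0 : 0 < Real.log m := Real.log_pos (by linarith)
      have hrh : h m ≤ r D + ENNReal.ofReal C :=
        (hA m (by omega)).trans (add_le_add_left (hr _ _ hD hKD) _)
      have hsp : 0 < Real.sqrt (1 / D) := by linarith
      have hlm : -Real.log D / 2 ≤ Real.log 2 + Real.log m := by
        have := hlsq 1 D one_pos hD
        rw [Real.log_one, zero_div, zero_add] at this
        rw [← this, ← Real.log_mul two_ne_zero (by positivity)]
        exact Real.log_le_log hsp (by linarith)
      simp only [hG, hH]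
      refine (ENNReal.div_le_div_right hrh _).trans ?_
      rw [ENNReal.add_div, ENNReal.ofReal_div_of_pos hlm0]
      refine add_le_add_left ?_ _
      refine div_tool _ _ _ _ hlm0 (by linarith) ?_
      have hpos : 0 < -Real.log D / 2 - Real.log 2 := by linarith
      rw [div_mul_eq_mul_div, le_div_iff₀ hpos]
      have : 0 < -Real.log D / 2 := by linarith
      exact mul_le_mul_of_nonneg_left (by linarith) this.le
  exact ⟨le_antisymm S1 S2, le_antisymm S3 S4⟩


/-- law of the first `n` samples -/
noncomputable def law {Ω : Type*} [MeasurableSpace Ω] (μ : Measure Ω) (L : ℕ)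
    (X : ℤ → Ω → Fin L → ℝ) (n : ℕ) : Measure (Fin n × Fin L → ℝ) :=
  μ.map (fun ω (p : Fin n × Fin L) => X ((p.1 : ℤ) + 1) ω p.2)

lemma blk_meas {Ω : Type*} [MeasurableSpace Ω]
    (L : ℕ) (X : ℤ → Ω → Fin L → ℝ) (hmeas : ∀ t, Measurable (X t)) (n : ℕ) :
    Measurable (fun ω (p : Fin n × Fin L) => X ((p.1 : ℤ) + 1) ω p.2) :=
  measurable_pi_lambda _ fun p => (measurable_pi_apply p.2).comp (hmeas _)

lemma law_prob {Ω : Type*} [MeasurableSpace Ω] (μ : Measure Ω) [IsProbabilityMeasure μ]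
    (L : ℕ) (X : ℤ → Ω → Fin L → ℝ) (hmeas : ∀ t, Measurable (X t)) (n : ℕ) :
    IsProbabilityMeasure (law μ L X n) :=
  Measure.isProbabilityMeasure_map (blk_meas L X hmeas n).aemeasurable

lemma law_sub {Ω : Type*} [MeasurableSpace Ω] (μ : Measure Ω)
    (L : ℕ) (X : ℤ → Ω → Fin L → ℝ) (hmeas : ∀ t, Measurable (X t))
    (hstat : Stationary μ X) (n l k : ℕ) (e : Fin l × Fin L → Fin n × Fin L)
    (he : ∀ p, ((e p).1 : ℕ) = k + p.1) (he2 : ∀ p, (e p).2 = p.2) :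
    (law μ L X n).map (fun x i => x (e i)) = law μ L X l := by
  unfold law
  have hG : Measurable (fun (x : ℤ → Fin L → ℝ) (p : Fin l × Fin L) => x ((p.1 : ℤ) + 1) p.2) := by
    fun_prop
  have hX : Measurable (fun ω (t : ℤ) => X t ω) := measurable_pi_lambda _ fun t => hmeas t
  have hXk : Measurable (fun ω (t : ℤ) => X (t + (k : ℤ)) ω) :=
    measurable_pi_lambda _ fun t => hmeas _
  have h := congrArg (Measure.map
    (fun (x : ℤ → Fin L → ℝ) (p : Fin l × Fin L) => x ((p.1 : ℤ) + 1) p.2)) (hstat k)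
  rw [Measure.map_map hG hXk, Measure.map_map hG hX] at h
  rw [Measure.map_map (by fun_prop) (blk_meas L X hmeas n)]
  refine Eq.trans ?_ h
  congr 1
  funext ω p
  simp only [Function.comp]
  rw [he2]
  have : (((e p).1 : ℕ) : ℤ) + 1 = ((p.1 : ℕ) : ℤ) + 1 + (k : ℤ) := by
    rw [he]; push_cast; ring
  rw [this]

lemma law_subadd {Ω : Type*} [MeasurableSpace Ω] (μ : Measure Ω) [IsProbabilityMeasure μ]
    (L : ℕ) (X : ℤ → Ω → Fin L → ℝ) (hmeas : ∀ t, Measurable (X t))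
    (hstat : Stationary μ X) (D : ℝ) (hD : 0 ≤ D) (k l : ℕ) :
    RD (law μ L X (k + l)) (((k + l : ℕ) : ℝ) * D) ≤
      RD (law μ L X k) ((k : ℝ) * D) + RD (law μ L X l) ((l : ℝ) * D) := by
  have := law_prob μ L X hmeas (k + l)
  let e : (Fin k × Fin L) ⊕ (Fin l × Fin L) ≃ Fin (k + l) × Fin L :=
    (Equiv.sumProdDistrib (Fin k) (Fin l) (Fin L)).symm.trans
      (finSumFinEquiv.prodCongr (Equiv.refl _))
  have h := subadd e (law μ L X (k + l)) (k * D) (l * D) (by positivity) (by positivity)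
  rw [law_sub μ L X hmeas hstat (k + l) k 0 (fun i => e (Sum.inl i))
      (by intro p; simp [e]) (by intro p; simp [e]),
    law_sub μ L X hmeas hstat (k + l) l k (fun i => e (Sum.inr i))
      (by intro p; simp [e]) (by intro p; simp [e])] at h
  have h2 : ((k + l : ℕ) : ℝ) * D = k * D + l * D := by push_cast; ring
  rw [h2]; exact h

lemma law_fin {Ω : Type*} [MeasurableSpace Ω] (μ : Measure Ω) [IsProbabilityMeasure μ]
    (L : ℕ) (X : ℤ → Ω → Fin L → ℝ) (hmeas : ∀ t, Measurable (X t))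
    (hstat : Stationary μ X) (D : ℝ) (hD : 0 < D) (k : ℕ)
    (hk : RD (law μ L X (k + 1)) (((k + 1 : ℕ) : ℝ) * D) ≠ ⊤) :
    RD (law μ L X 1) (((1 : ℕ) : ℝ) * D) ≠ ⊤ := by
  have := law_prob μ L X hmeas 1
  obtain ⟨q, c0, iq, hc0, hq⟩ := exists_q
  obtain ⟨N, hN⟩ := exists_nat_ge ((L : ℝ) / D)
  set m := N + 1 with hm
  have hm1 : (1 : ℝ) ≤ m := by rw [hm]; push_cast; linarith [Nat.cast_nonneg (α := ℝ) N]
  have hNm : (N : ℝ) ≤ m := by rw [hm]; push_cast; linarith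
  have hle : (Fintype.card (Fin 1 × Fin L) : ℝ) / (m : ℝ) ^ 2 ≤ ((1 : ℕ) : ℝ) * D := by
    simp only [Fintype.card_prod, Fintype.card_fin, one_mul, Nat.cast_one]
    rw [div_le_iff₀ (by positivity)]
    rw [div_le_iff₀ hD] at hN
    nlinarith [mul_le_mul_of_nonneg_right (show (N : ℝ) ≤ (m : ℝ) ^ 2 by nlinarith) hD.le]
  have h1 := UB (law μ L X 1) m (by omega) _ hle
  have he : Function.Injective (fun p : Fin 1 × Fin L =>
      ((Fin.castLE (by omega) p.1, p.2) : Fin (k + 1) × Fin L)) := by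
    intro a b h
    simp only [Prod.mk.injEq] at h
    exact Prod.ext (Fin.castLE_injective _ h.1) h.2
  have h2 := LB hc0 hq _ he (law μ L X (k + 1)) (((k + 1 : ℕ) : ℝ) * D) (by positivity) m
  rw [law_sub μ L X hmeas hstat (k + 1) 1 0 (fun p : Fin 1 × Fin L =>
      ((Fin.castLE (by omega) p.1, p.2) : Fin (k + 1) × Fin L)) (by intro p; simp)
      (by intro p; rfl)] at h2
  exact ne_top_of_le_ne_top (ENNReal.add_ne_top.2 ⟨hk, ENNReal.ofReal_ne_top⟩) (h1.trans h2)

lemma RD_anti {ι : Type*} [Fintype ι] (ν : Measure (ι → ℝ)) {D D' : ℝ} (h : D ≤ D') :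
    RD ν D' ≤ RD ν D :=
  le_RD _ _ _ fun π h1 h2 h3 =>
    iInf_le_of_le π (iInf_le_of_le h1 (iInf_le_of_le h2
      (iInf_le_of_le (h3.trans (ENNReal.ofReal_le_ofReal h)) le_rfl)))

/-- limiting per-letter rate-distortion function -/
noncomputable def rlim {Ω : Type*} [MeasurableSpace Ω] (μ : Measure Ω)
    (L : ℕ) (X : ℤ → Ω → Fin L → ℝ) (D : ℝ) : ℝ≥0∞ :=
  ⨅ k : ℕ, RD (law μ L X (k + 1)) (((k + 1 : ℕ) : ℝ) * D) / ((k : ℝ≥0∞) + 1)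

lemma rlim_A {Ω : Type*} [MeasurableSpace Ω] (μ : Measure Ω) [IsProbabilityMeasure μ]
    (L : ℕ) (X : ℤ → Ω → Fin L → ℝ) (hmeas : ∀ t, Measurable (X t))
    {q : Measure ℤ} {c0 : ℝ} [IsProbabilityMeasure q] (hc0 : 0 ≤ c0)
    (hq : ∀ z : ℤ, q {z} = ENNReal.ofReal (Real.exp (-(|(z : ℝ)| + c0))))
    (m : ℕ) (hm : 1 ≤ m) :
    entRate μ X m ≤ rlim μ L X (1 / (m : ℝ) ^ 2) + ENNReal.ofReal (1 + L * (2 + c0)) := by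
  unfold rlim
  rw [ENNReal.iInf_add]
  refine le_iInf fun k => ?_
  refine (iInf_le _ k).trans ?_
  have hm0 : (0 : ℝ) < m := by exact_mod_cast hm
  have h := LB hc0 hq id Function.injective_id (law μ L X (k + 1))
    (((k + 1 : ℕ) : ℝ) * (1 / (m : ℝ) ^ 2)) (by positivity) m
  have hid : (fun (x : Fin (k + 1) × Fin L → ℝ) j => x (id j)) = id := rfl
  rw [hid, Measure.map_id] at h
  rw [entropy_eq μ L X hmeas m (k + 1) hm]
  have hk0 : ((k : ℝ≥0∞) + 1) ≠ 0 := by simp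
  have hkt : ((k : ℝ≥0∞) + 1) ≠ ⊤ := by simp
  have hc : ENNReal.ofReal ((m : ℝ) ^ 2 * (((k + 1 : ℕ) : ℝ) * (1 / (m : ℝ) ^ 2)) +
      Fintype.card (Fin (k + 1) × Fin L) * (2 + c0)) =
      ENNReal.ofReal (1 + L * (2 + c0)) * ((k : ℝ≥0∞) + 1) := by
    have : ((k : ℝ≥0∞) + 1) = ENNReal.ofReal ((k : ℝ) + 1) := by
      rw [ENNReal.ofReal_add (by positivity) (by positivity)]; simp
    rw [this, ← ENNReal.ofReal_mul (by positivity)]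
    congr 1
    simp only [Fintype.card_prod, Fintype.card_fin]
    push_cast
    field_simp
  rw [hc] at h
  refine (ENNReal.div_le_div_right h _).trans ?_
  rw [ENNReal.add_div, ENNReal.mul_div_cancel_right hk0 hkt]

lemma rlim_B {Ω : Type*} [MeasurableSpace Ω] (μ : Measure Ω) [IsProbabilityMeasure μ]
    (L : ℕ) (X : ℤ → Ω → Fin L → ℝ) (hmeas : ∀ t, Measurable (X t))
    (m : ℕ) (hm : 1 ≤ m) :
    rlim μ L X (((L : ℝ) + 1) / (m : ℝ) ^ 2) ≤ entRate μ X m := by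
  refine iInf_mono fun k => ?_
  have := law_prob μ L X hmeas (k + 1)
  have hm0 : (0 : ℝ) < m := by exact_mod_cast hm
  rw [entropy_eq μ L X hmeas m (k + 1) hm]
  refine ENNReal.div_le_div_right (UB (law μ L X (k + 1)) m hm _ ?_) _
  simp only [Fintype.card_prod, Fintype.card_fin]
  rw [← mul_div_assoc]
  refine div_le_div_of_nonneg_right ?_ (by positivity)
  push_cast
  nlinarith [Nat.cast_nonneg (α := ℝ) k]


end RDaux

/-- the information dimension rates equal the rate-distortion dimensions:
the per-letter rate-distortion function `R(X_1^k, kD)/k` converges as `k → ∞` (by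
stationarity), and `d̄({X_t})` (resp. `d̲({X_t})`) equals twice the limsup (resp. liminf)
as `D ↓ 0` of this limit divided by `−log D`. -/
theorem stmt7 {Ω : Type*} [MeasurableSpace Ω] (μ : Measure Ω) [IsProbabilityMeasure μ]
    (L : ℕ) (X : ℤ → Ω → Fin L → ℝ) (hmeas : ∀ t, Measurable (X t))
    (hstat : Stationary μ X) :
    ∃ r : ℝ → ℝ≥0∞,
      (∀ D : ℝ, 0 < D →
        Tendsto (fun k : ℕ =>
            RD (μ.map (fun ω (p : Fin (k + 1) × Fin L) => X ((p.1 : ℤ) + 1) ω p.2))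
                (((k : ℝ) + 1) * D) / ((k : ℝ≥0∞) + 1))
          atTop (nhds (r D))) ∧
      dimRateUpper μ X =
        2 * Filter.limsup (fun D : ℝ => r D / ENNReal.ofReal (-Real.log D))
          (nhdsWithin 0 (Set.Ioi 0)) ∧
      dimRateLower μ X =
        2 * Filter.liminf (fun D : ℝ => r D / ENNReal.ofReal (-Real.log D))
          (nhdsWithin 0 (Set.Ioi 0)) := by
  obtain ⟨q, c0, iq, hc0, hq⟩ := RDaux.exists_q
  obtain ⟨h1, h2⟩ := RDaux.asymp (entRate μ X) (RDaux.rlim μ L X) (1 + L * (2 + c0)) ((L : ℝ) + 1)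
    (by positivity) (by linarith [Nat.cast_nonneg (α := ℝ) L])
    (fun D D' _ hDD => iInf_mono fun k => ENNReal.div_le_div_right
      (RDaux.RD_anti _ (mul_le_mul_of_nonneg_left hDD (by positivity))) _)
    (fun m hm => RDaux.rlim_A μ L X hmeas hc0 hq m hm)
    (fun m hm => RDaux.rlim_B μ L X hmeas m hm)
  refine ⟨RDaux.rlim μ L X, fun D hD => ?_, h1, h2⟩
  have h := RDaux.fekete (fun n => RD (RDaux.law μ L X n) ((n : ℝ) * D))
    (fun k l => RDaux.law_subadd μ L X hmeas hstat D hD.le k l)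
    (fun k hk => RDaux.law_fin μ L X hmeas hstat D hD k hk)
  simp only [Nat.cast_add, Nat.cast_one] at h
  simpa only [RDaux.rlim, RDaux.law, Nat.cast_add, Nat.cast_one] using h
end

section
/- (Bussgang's theorem for the uniform quantizer.) Let (X, Y) be a pair of real random variables whose joint law is a (bivariate) Gaussian measure on ℝ², with Var(Y) = σ² > 0, and let m ≥ 1 be an integer. Then Cov(X, [Y]_m) = a · Cov(X, Y), where a := Cov(Y, [Y]_m)/σ². -/
open MeasureTheory ProbabilityTheory Filter Set
open scoped ENNReal NNReal

/-- Covariance of two real random variables. -/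
noncomputable def cov {Ω : Type*} [MeasurableSpace Ω] (μ : Measure Ω) (X Y : Ω → ℝ) : ℝ :=
  ∫ ω, (X ω - ∫ x, X x ∂μ) * (Y ω - ∫ x, Y x ∂μ) ∂μ

/-- A probability measure on `ℝ²` is (bivariate) Gaussian iff every linear functional
pushes it forward to a one-dimensional Gaussian law. -/
def IsGaussianPair (π : Measure (ℝ × ℝ)) : Prop :=
  IsProbabilityMeasure π ∧
    ∀ a b : ℝ, ∃ (c : ℝ) (v : ℝ≥0), π.map (fun p => a * p.1 + b * p.2) = gaussianReal c v

/-- Bussgang's theorem for the uniform quantizer: if `(X, Y)` is jointly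
Gaussian with `Var(Y) = σ² > 0`, then `Cov(X, [Y]_m) = a·Cov(X, Y)` with
`a = Cov(Y, [Y]_m)/σ²`. -/
theorem stmt10 {Ω : Type*} [MeasurableSpace Ω] (μ : Measure Ω) [IsProbabilityMeasure μ]
    (X Y : Ω → ℝ) (hX : Measurable X) (hY : Measurable Y)
    (hG : IsGaussianPair (μ.map (fun ω => (X ω, Y ω))))
    (hσ : 0 < cov μ Y Y) (m : ℕ) (hm : 1 ≤ m) :
    cov μ X (fun ω => quant m (Y ω)) =
      (cov μ Y (fun ω => quant m (Y ω)) / cov μ Y Y) * cov μ X Y := by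
  have hG2 : IsGaussian (μ.map (fun ω => (X ω, Y ω))) := by
    obtain ⟨hp, h⟩ := hG
    refine ⟨fun L => ?_⟩
    obtain ⟨c, v, hcv⟩ := h (L (1, 0)) (L (0, 1))
    have hL : (fun p : ℝ × ℝ => L (1, 0) * p.1 + L (0, 1) * p.2) = L := by
      funext p
      have : p = p.1 • ((1 : ℝ), (0 : ℝ)) + p.2 • ((0 : ℝ), (1 : ℝ)) := by
        ext <;> simp
      conv_rhs => rw [this, map_add, map_smul, map_smul]
      simp [mul_comm]
    rw [hL] at hcv
    have hi : ∫ x, L x ∂(μ.map (fun ω => (X ω, Y ω))) = c := by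
      rw [← integral_map (f := fun x : ℝ => x) (by fun_prop) (by fun_prop), hcv]
      exact integral_id_gaussianReal
    have hv : Var[L; μ.map (fun ω => (X ω, Y ω))] = v := by
      have := variance_map (μ := μ.map (fun ω => (X ω, Y ω))) (X := id) (Y := L)
        (by fun_prop) (by fun_prop)
      rw [hcv, variance_id_gaussianReal] at this
      simpa using this.symm
    rw [hi, hv, hcv]
    simp
  have hXY : HasGaussianLaw (fun ω => (X ω, Y ω)) μ := ⟨hG2⟩
  have e : ∀ U V : Ω → ℝ, cov μ U V = cov[U, V; μ] := fun U V => rfl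
  simp only [e] at hσ ⊢
  set b : ℝ := cov[X, Y; μ] / cov[Y, Y; μ] with hb
  have hX2 : MemLp X 2 μ := hXY.fst.memLp_two
  have hY2 : MemLp Y 2 μ := hXY.snd.memLp_two
  have hm0 : (0 : ℝ) < m := by exact_mod_cast hm
  have hqm : Measurable (quant m) := by
    unfold quant
    fun_prop
  have hQ2 : MemLp (fun ω => quant m (Y ω)) 2 μ := by
    have hd : MemLp (fun ω => quant m (Y ω) - Y ω) 2 μ := by
      refine MemLp.of_bound ((hqm.comp hY).sub hY).aestronglyMeasurable (1 / m) ?_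
      refine Eventually.of_forall fun ω => ?_
      have h1 := Int.floor_le ((m : ℝ) * Y ω)
      have h2 := Int.lt_floor_add_one ((m : ℝ) * Y ω)
      have h3 : quant m (Y ω) - Y ω = (⌊(m : ℝ) * Y ω⌋ - m * Y ω) / m := by
        unfold quant
        field_simp
      rw [h3, Real.norm_eq_abs, abs_div, abs_of_pos hm0]
      gcongr
      rw [abs_le]
      constructor <;> linarith
    have := hd.add hY2
    refine this.congr_norm (hqm.comp hY).aestronglyMeasurable (Eventually.of_forall fun ω => ?_)
    simp
  have hbY : MemLp (fun ω => b * Y ω) 2 μ := hY2.const_mul b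
  have hZG : HasGaussianLaw (fun ω => (X ω - b * Y ω, Y ω)) μ := by
    have := hXY.map_fun ((ContinuousLinearMap.fst ℝ ℝ ℝ - b • ContinuousLinearMap.snd ℝ ℝ ℝ).prod
      (ContinuousLinearMap.snd ℝ ℝ ℝ))
    simpa using this
  have hc0 : cov[fun ω => X ω - b * Y ω, Y; μ] = 0 := by
    rw [covariance_fun_sub_left hX2 hbY hY2, covariance_const_mul_left, hb]
    field_simp
    ring
  have hind := hZG.indepFun_of_covariance_eq_zero hc0
  have hind2 : IndepFun (fun ω => X ω - b * Y ω) (fun ω => quant m (Y ω)) μ :=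
    hind.comp measurable_id hqm
  have h0 := hind2.covariance_eq_zero (hX2.sub hbY) hQ2
  rw [covariance_fun_sub_left hX2 hbY hQ2, covariance_const_mul_left] at h0
  rw [sub_eq_zero.1 h0, hb]
  ring
end

section
/- Let (X_1, X_2) be a pair of real random variables whose joint law is a (bivariate) Gaussian measure on ℝ², with Var(X_1) = σ_1² > 0 and Var(X_2) = σ_2² > 0, and let m ≥ 1 be an integer. Set Z_i := [X_i]_m, N_i := X_i − Z_i, and a_i := Cov(X_i, Z_i)/σ_i² for i = 1, 2. Then Cov(Z_1, Z_2) = (a_1 + a_2 − 1)·Cov(X_1, X_2) + Cov(N_1, N_2). -/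
open MeasureTheory ProbabilityTheory Filter Set
open scoped ENNReal NNReal

lemma gp_law {Ω : Type*} [MeasurableSpace Ω] (μ : Measure Ω) [IsProbabilityMeasure μ]
    (X₁ X₂ : Ω → ℝ) (hX₁ : Measurable X₁) (hX₂ : Measurable X₂)
    (hG : IsGaussianPair (μ.map (fun ω => (X₁ ω, X₂ ω)))) :
    HasGaussianLaw (fun ω => (X₁ ω, X₂ ω)) μ := by
  obtain ⟨hp, h⟩ := hG
  refine ⟨isGaussian_of_map_eq_gaussianReal fun L => ?_⟩
  obtain ⟨c, v, hcv⟩ := h (L (1, 0)) (L (0, 1))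
  have hL : (L : ℝ × ℝ → ℝ) = fun p => L (1, 0) * p.1 + L (0, 1) * p.2 := by
    funext p
    have : p = p.1 • ((1, 0) : ℝ × ℝ) + p.2 • ((0, 1) : ℝ × ℝ) := by ext <;> simp
    conv_lhs => rw [this]
    rw [map_add, map_smul, map_smul, smul_eq_mul, smul_eq_mul]
    ring
  have hcv' := hcv
  rw [← hL] at hcv'
  exact ⟨c, v, hcv'⟩

lemma cov_reg {Ω : Type*} [MeasurableSpace Ω] (μ : Measure Ω) [IsProbabilityMeasure μ]
    (X Y : Ω → ℝ) (hG : HasGaussianLaw (fun ω => (X ω, Y ω)) μ)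
    (hσ : 0 < covariance X X μ) (g : ℝ → ℝ) (hg : Measurable g)
    (hgX : MemLp (fun ω => g (X ω)) 2 μ) :
    covariance Y (fun ω => g (X ω)) μ =
      covariance X (fun ω => g (X ω)) μ / covariance X X μ * covariance X Y μ := by
  have hX := hG.fst.memLp_two
  have hY := hG.snd.memLp_two
  set c := covariance X Y μ / covariance X X μ with hc
  have hcX : MemLp (fun ω => c * X ω) 2 μ := hX.const_mul c
  have hW : HasGaussianLaw (fun ω => (X ω, Y ω - c * X ω)) μ :=
    hG.map_fun ((ContinuousLinearMap.fst ℝ ℝ ℝ).prod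
      (ContinuousLinearMap.snd ℝ ℝ ℝ - c • ContinuousLinearMap.fst ℝ ℝ ℝ))
  have h0 : covariance X (fun ω => Y ω - c * X ω) μ = 0 := by
    rw [covariance_fun_sub_right hX hY hcX, covariance_const_mul_right, hc]
    field_simp
    ring
  have hi := hW.indepFun_of_covariance_eq_zero h0
  have hi2 := hi.comp hg measurable_id
  have h1 : covariance (fun ω => Y ω - c * X ω) (fun ω => g (X ω)) μ = 0 :=
    hi2.symm.covariance_eq_zero (hY.sub hcX) hgX
  rw [covariance_fun_sub_left hY hcX hgX, covariance_const_mul_left] at h1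
  rw [sub_eq_zero.1 h1, hc]
  ring

lemma quant_meas (m : ℕ) : Measurable (quant m) := by
  unfold quant
  fun_prop

lemma quant_memLp {Ω : Type*} [MeasurableSpace Ω] (μ : Measure Ω) [IsProbabilityMeasure μ]
    (X : Ω → ℝ) (hX : Measurable X) (h2 : MemLp X 2 μ) (m : ℕ) (hm : 1 ≤ m) :
    MemLp (fun ω => quant m (X ω)) 2 μ := by
  have hN : MemLp (fun ω => X ω - quant m (X ω)) 2 μ := by
    refine MemLp.of_bound (C := 1) ?_ (Eventually.of_forall fun ω => ?_)
    · exact (hX.sub ((quant_meas m).comp hX)).aestronglyMeasurable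
    · have hm' : (1 : ℝ) ≤ m := by exact_mod_cast hm
      have e : X ω - quant m (X ω) = Int.fract ((m : ℝ) * X ω) / m := by
        rw [quant, Int.fract]; field_simp
      rw [e, Real.norm_eq_abs, abs_of_nonneg (div_nonneg (Int.fract_nonneg _) (by linarith)),
        div_le_one (by linarith)]
      exact (Int.fract_lt_one _).le.trans hm'
  have := h2.sub hN
  convert this using 1
  funext ω
  simp

/-- for jointly Gaussian `(X₁, X₂)` with positive variances, writing
`Z_i = [X_i]_m`, `N_i = X_i − Z_i` and `a_i = Cov(X_i, Z_i)/σ_i²`, one has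
`Cov(Z₁, Z₂) = (a₁ + a₂ − 1)·Cov(X₁, X₂) + Cov(N₁, N₂)`. -/
theorem stmt12 {Ω : Type*} [MeasurableSpace Ω] (μ : Measure Ω) [IsProbabilityMeasure μ]
    (X₁ X₂ : Ω → ℝ) (hX₁ : Measurable X₁) (hX₂ : Measurable X₂)
    (hG : IsGaussianPair (μ.map (fun ω => (X₁ ω, X₂ ω))))
    (hσ₁ : 0 < cov μ X₁ X₁) (hσ₂ : 0 < cov μ X₂ X₂) (m : ℕ) (hm : 1 ≤ m) :
    cov μ (fun ω => quant m (X₁ ω)) (fun ω => quant m (X₂ ω)) =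
      (cov μ X₁ (fun ω => quant m (X₁ ω)) / cov μ X₁ X₁ +
        cov μ X₂ (fun ω => quant m (X₂ ω)) / cov μ X₂ X₂ - 1) * cov μ X₁ X₂ +
      cov μ (fun ω => X₁ ω - quant m (X₁ ω)) (fun ω => X₂ ω - quant m (X₂ ω)) := by
  have hL := gp_law μ X₁ X₂ hX₁ hX₂ hG
  have hL' : HasGaussianLaw (fun ω => (X₂ ω, X₁ ω)) μ :=
    hL.map_fun ((ContinuousLinearMap.snd ℝ ℝ ℝ).prod (ContinuousLinearMap.fst ℝ ℝ ℝ))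
  have e : ∀ X Y : Ω → ℝ, cov μ X Y = covariance X Y μ := fun X Y => rfl
  simp only [e] at hσ₁ hσ₂ ⊢
  have m1 := hL.fst.memLp_two
  have m2 := hL.snd.memLp_two
  have q1 := quant_memLp μ X₁ hX₁ m1 m hm
  have q2 := quant_memLp μ X₂ hX₂ m2 m hm
  have r1 := cov_reg μ X₁ X₂ hL hσ₁ (quant m) (quant_meas m) q1
  have r2 := cov_reg μ X₂ X₁ hL' hσ₂ (quant m) (quant_meas m) q2
  rw [covariance_fun_sub_fun_sub m1 q1 m2 q2, r2, covariance_comm (fun ω => quant m (X₁ ω)) X₂, r1,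
    covariance_comm X₂ X₁]
  ring
end
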